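/- Lemma B.7 (bound on the OMD regret term for linear bandits): Let S be the final set of rounds at which Algorithm 2 increased its learning rate, and S' = S \ {1, T+1}. If η ≤ 1/(80d), then Σ_{t=1}^T ⟨w⁺_t − u⁺, ℓ̂⁺_t⟩ ≤ Õ(ν/η) − (Σ_{s∈S'} ‖u⁺‖_{H_s})/(500 η d ln(νT)) + 40 η d² L̄_T, where L̄_T = Σ_{t=1}^T |⟨w̃⁺_t, ℓ⁺_t⟩| and Õ hides factors logarithmic in d, ν, T. -/

import Mathlib

open MeasureTheory Real Finset Matrix

/-! Common notions for the linear-bandit setting (self-concordant barriers,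
the lifted normal barrier, quadratic norms, Bregman divergences, Minkowsky functions). -/

/-- Euclidean dot product on `ℝ^n`. -/
noncomputable def dotp {n : ℕ} (x y : Fin n → ℝ) : ℝ := ∑ i, x i * y i

/-- Quadratic norm `‖h‖_M = √(hᵀ M h)`. -/
noncomputable def qnorm {n : ℕ} (M : Matrix (Fin n) (Fin n) ℝ) (h : Fin n → ℝ) : ℝ :=
  Real.sqrt (dotp h (M.mulVec h))

/-- First directional derivative `Df(x)[h]`. -/
noncomputable def der1 {n : ℕ} (f : (Fin n → ℝ) → ℝ) (x h : Fin n → ℝ) : ℝ :=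
  fderiv ℝ f x h

/-- Second directional derivative `D²f(x)[h₁,h₂]`. -/
noncomputable def der2 {n : ℕ} (f : (Fin n → ℝ) → ℝ) (x h₁ h₂ : Fin n → ℝ) : ℝ :=
  iteratedFDeriv ℝ 2 f x ![h₁, h₂]

/-- Third directional derivative `D³f(x)[h,h,h]`. -/
noncomputable def der3 {n : ℕ} (f : (Fin n → ℝ) → ℝ) (x h : Fin n → ℝ) : ℝ :=
  iteratedFDeriv ℝ 3 f x ![h, h, h]

/-- Hessian matrix `∇²f(x)`. -/
noncomputable def hess {n : ℕ} (f : (Fin n → ℝ) → ℝ) (x : Fin n → ℝ) :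
    Matrix (Fin n) (Fin n) ℝ :=
  Matrix.of fun i j => der2 f x (Pi.single i 1) (Pi.single j 1)

/-- Gradient vector `∇f(x)`. -/
noncomputable def gradv {n : ℕ} (f : (Fin n → ℝ) → ℝ) (x : Fin n → ℝ) : Fin n → ℝ :=
  fun i => fderiv ℝ f x (Pi.single i 1)

/-- Bregman divergence `D_f(u,w) = f(u) − f(w) − ⟨∇f(w), u − w⟩`. -/
noncomputable def breg {n : ℕ} (f : (Fin n → ℝ) → ℝ) (u w : Fin n → ℝ) : ℝ :=
  f u - f w - dotp (gradv f w) (u - w)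

/-- `ψ` is a `ν`-self-concordant barrier for `K`. -/
structure IsSCB {n : ℕ} (K : Set (Fin n → ℝ)) (ψ : (Fin n → ℝ) → ℝ) (ν : ℝ) : Prop where
  smooth : ContDiffOn ℝ 3 ψ (interior K)
  convexOn : ConvexOn ℝ (interior K) ψ
  blowup : ∀ x ∈ frontier K, Filter.Tendsto ψ (nhdsWithin x (interior K)) Filter.atTop
  selfConc : ∀ w ∈ interior K, ∀ h, |der3 ψ w h| ≤ 2 * Real.sqrt (der2 ψ w h h) ^ 3
  gradBound : ∀ w ∈ interior K, ∀ h,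
    |der1 ψ w h| ≤ Real.sqrt ν * Real.sqrt (der2 ψ w h h)

/-- Lift `w ∈ ℝ^d` to `(w,1) ∈ ℝ^{d+1}`. -/
noncomputable def liftv {d : ℕ} (w : Fin d → ℝ) : Fin (d + 1) → ℝ := Fin.snoc w 1

/-- The lifted barrier `Ψ(w,b) = 400 (ψ(w/b) − 2ν ln b)`, an `800ν`-normal barrier on
the conic hull of `Ω⁺`. -/
noncomputable def liftedBarrier {d : ℕ} (ψ : (Fin d → ℝ) → ℝ) (ν : ℝ) :
    (Fin (d + 1) → ℝ) → ℝ :=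
  fun x => 400 * (ψ (fun i => x i.castSucc / x (Fin.last d)) -
    2 * ν * Real.log (x (Fin.last d)))

/-- Minkowsky function `π_w(u) = inf {s > 0 : w + (u − w)/s ∈ K}`. -/
noncomputable def mink {n : ℕ} (K : Set (Fin n → ℝ)) (w u : Fin n → ℝ) : ℝ :=
  sInf {s : ℝ | 0 < s ∧ w + s⁻¹ • (u - w) ∈ K}

section MM

lemma eigvec_pos {n : ℕ} {N : Matrix (Fin n) (Fin n) ℝ} (hN : N.IsHermitian) (i : Fin n) :
    0 < (hN.eigenvectorBasis i).ofLp ⬝ᵥ (hN.eigenvectorBasis i).ofLp := by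
  have := hN.eigenvectorBasis.orthonormal.ne_zero i
  have h0 := dotProduct_star_self_pos_iff (v := (hN.eigenvectorBasis i).ofLp)
  simp only [star_trivial] at h0
  rw [h0]
  intro h; apply this; ext j; simp [h]

lemma herm_det_ge_two {n : ℕ} (N : Matrix (Fin n) (Fin n) ℝ) (hN : N.IsHermitian)
    (h1 : ∀ x, x ⬝ᵥ x ≤ x ⬝ᵥ N *ᵥ x) (q : Fin n → ℝ) (hq : 2 * (q ⬝ᵥ q) < q ⬝ᵥ N *ᵥ q) :
    2 ≤ N.det := by
  have hge : ∀ i, 1 ≤ hN.eigenvalues i := by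
    intro i
    have h := h1 (hN.eigenvectorBasis i).ofLp
    rw [hN.mulVec_eigenvectorBasis, dotProduct_smul, smul_eq_mul] at h
    have hp := eigvec_pos hN i
    nlinarith
  have hex : ∃ i, 2 ≤ hN.eigenvalues i := by
    by_contra hcon
    push Not at hcon
    have hH : ((2:ℝ) • (1 : Matrix (Fin n) (Fin n) ℝ) - N).PosSemidef := by
      have e : (2:ℝ) • (1 : Matrix (Fin n) (Fin n) ℝ) - N =
          (Unitary.conjStarAlgAut ℝ (Matrix (Fin n) (Fin n) ℝ) hN.eigenvectorUnitary)
            (diagonal (fun i => 2 - hN.eigenvalues i)) := by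
        have : diagonal (fun i => 2 - hN.eigenvalues i) =
            (2:ℝ) • (1 : Matrix (Fin n) (Fin n) ℝ) - diagonal (RCLike.ofReal ∘ hN.eigenvalues) := by
          ext i j
          by_cases h : i = j
          · subst h; simp
          · simp [h]
        rw [this, map_sub, map_smul, map_one, ← hN.spectral_theorem]
      rw [e, Unitary.conjStarAlgAut_apply]
      exact (PosSemidef.diagonal (fun i => by simpa using (hcon i).le)).mul_mul_conjTranspose_same _
    have := hH.dotProduct_mulVec_nonneg q
    simp [sub_mulVec, smul_mulVec] at this
    linarith
  obtain ⟨i, hi⟩ := hex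
  rw [hN.det_eq_prod_eigenvalues]
  simp only [RCLike.ofReal_real_eq_id, id]
  rw [← Finset.mul_prod_erase _ _ (Finset.mem_univ i)]
  have : 1 ≤ ∏ x ∈ Finset.univ.erase i, hN.eigenvalues x := by
    exact Finset.one_le_prod fun i _ => hge i
  nlinarith

lemma herm_det_le {n : ℕ} (N : Matrix (Fin n) (Fin n) ℝ) (hN : N.IsHermitian) (c : ℝ)
    (h0 : ∀ x, 0 ≤ x ⬝ᵥ N *ᵥ x) (h1 : ∀ x, x ⬝ᵥ N *ᵥ x ≤ c * (x ⬝ᵥ x)) :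
    N.det ≤ c ^ n := by
  rw [hN.det_eq_prod_eigenvalues]
  simp only [RCLike.ofReal_real_eq_id, id]
  refine (Finset.prod_le_prod (g := fun _ => c) (fun i _ => ?_) (fun i _ => ?_)).trans (by simp)
  all_goals
    have h := h1 (hN.eigenvectorBasis i).ofLp
    have h' := h0 (hN.eigenvectorBasis i).ofLp
    rw [hN.mulVec_eigenvectorBasis, dotProduct_smul, smul_eq_mul] at h h'
    have hp := eigvec_pos hN i
    nlinarith

open scoped MatrixOrder in
lemma posdef_factor {n : ℕ} (A : Matrix (Fin n) (Fin n) ℝ) (hA : A.PosDef) :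
    ∃ B : Matrix (Fin n) (Fin n) ℝ, A = Bᵀ * B ∧ IsUnit B.det := by
  obtain ⟨B, hB⟩ := CStarAlgebra.nonneg_iff_eq_star_mul_self.mp hA.posSemidef.nonneg
  refine ⟨B, ?_, ?_⟩
  · simpa [star_eq_conjTranspose, conjTranspose_eq_transpose_of_trivial] using hB
  · have := hA.det_pos
    rw [hB, det_mul] at this
    exact isUnit_iff_ne_zero.2 (fun h => by simp [h] at this)

lemma conj_facts {n : ℕ} (B M : Matrix (Fin n) (Fin n) ℝ) (hB : IsUnit B.det) (hM : M.IsHermitian) :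
    ((B⁻¹)ᵀ * M * B⁻¹).IsHermitian ∧
    (∀ x, x ⬝ᵥ ((B⁻¹)ᵀ * M * B⁻¹) *ᵥ x = (B⁻¹ *ᵥ x) ⬝ᵥ M *ᵥ (B⁻¹ *ᵥ x)) ∧
    (∀ x, x ⬝ᵥ x = (B⁻¹ *ᵥ x) ⬝ᵥ (Bᵀ * B) *ᵥ (B⁻¹ *ᵥ x)) ∧
    M.det = (Bᵀ * B).det * ((B⁻¹)ᵀ * M * B⁻¹).det := by
  have hq : ∀ (X : Matrix (Fin n) (Fin n) ℝ) x, x ⬝ᵥ ((B⁻¹)ᵀ * X * B⁻¹) *ᵥ x =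
      (B⁻¹ *ᵥ x) ⬝ᵥ X *ᵥ (B⁻¹ *ᵥ x) := by
    intro X x
    rw [← mulVec_mulVec, ← mulVec_mulVec, dotProduct_mulVec, vecMul_transpose]
  refine ⟨?_, hq M, ?_, ?_⟩
  · have := isHermitian_conjTranspose_mul_mul (B⁻¹) hM
    simpa [conjTranspose_eq_transpose_of_trivial] using this
  · intro x
    rw [← hq]
    have : (B⁻¹)ᵀ * (Bᵀ * B) * B⁻¹ = 1 := by
      rw [← Matrix.mul_assoc, ← transpose_mul, mul_nonsing_inv _ hB]
      simp [mul_nonsing_inv _ hB]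
    rw [this, one_mulVec]
  · have h2 : B.det * B⁻¹.det = 1 := by rw [← det_mul, mul_nonsing_inv _ hB, det_one]
    simp only [det_mul, det_transpose]
    linear_combination (-(M.det) * (B.det * B⁻¹.det + 1)) * h2

lemma det_double {n : ℕ} (A M : Matrix (Fin n) (Fin n) ℝ) (hA : A.PosDef) (hM : M.PosSemidef)
    (p : Fin n → ℝ) (hp : p ⬝ᵥ A *ᵥ p < p ⬝ᵥ M *ᵥ p) : 2 * A.det ≤ (A + M).det := by
  obtain ⟨B, rfl, hB⟩ := posdef_factor A hA
  obtain ⟨h1, h2, h3, h4⟩ := conj_facts B (Bᵀ * B + M) hB (hA.isHermitian.add hM.isHermitian)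
  rw [h4]
  have hdet := hA.det_pos
  have := herm_det_ge_two _ h1 (fun x => ?_) (B *ᵥ p) ?_
  · nlinarith
  · rw [h2, h3, add_mulVec, dotProduct_add]
    have := hM.dotProduct_mulVec_nonneg (B⁻¹ *ᵥ x)
    simp only [star_trivial] at this
    linarith
  · rw [h2, h3]
    have : B⁻¹ *ᵥ (B *ᵥ p) = p := by rw [mulVec_mulVec, nonsing_inv_mul _ hB, one_mulVec]
    rw [this, add_mulVec, dotProduct_add]
    linarith

lemma det_le_of_le {n : ℕ} (A M : Matrix (Fin n) (Fin n) ℝ) (hA : A.PosDef) (hM : M.PosSemidef)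
    (c : ℝ) (h : ∀ p, p ⬝ᵥ M *ᵥ p ≤ c * (p ⬝ᵥ A *ᵥ p)) : M.det ≤ c ^ n * A.det := by
  obtain ⟨B, rfl, hB⟩ := posdef_factor A hA
  obtain ⟨h1, h2, h3, h4⟩ := conj_facts B M hB hM.isHermitian
  rw [h4, mul_comm]
  have hdet := hA.det_pos
  have := herm_det_le _ h1 c (fun x => ?_) (fun x => ?_)
  · nlinarith
  · rw [h2]
    have := hM.dotProduct_mulVec_nonneg (B⁻¹ *ᵥ x)
    simpa only [star_trivial] using this
  · rw [h2, h3]; exact h _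

end MM


section AB
open Set Filter Topology

lemma oned_barrier {φ φ' : ℝ → ℝ} {ν : ℝ} (hν : 0 < ν)
    (hd : ∀ t ∈ Ico (0:ℝ) 1, HasDerivAt φ (φ' t) t)
    (hb : ∀ t ∈ Ico (0:ℝ) 1, φ t ^ 2 ≤ ν * φ' t) :
    ∀ t ∈ Ico (0:ℝ) 1, φ t * (1 - t) ≤ ν := by
  intro t0 ht0
  by_contra hcon
  push Not at hcon
  have h1 : 0 < 1 - t0 := by linarith [ht0.2]
  have hm : 0 < φ t0 := by
    by_contra h
    push Not at h
    nlinarith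
  obtain ⟨t1, ht1, h01⟩ : ∃ t1 < 1, t0 < t1 ∧ ν < φ t0 * (t1 - t0) := by
    have : ν / φ t0 < 1 - t0 := by rw [div_lt_iff₀ hm]; linarith
    have h0 : 0 < ν / φ t0 := by positivity
    refine ⟨t0 + (ν / φ t0 + (1 - t0)) / 2, by linarith, by linarith, ?_⟩
    have h2 : ν = φ t0 * (ν / φ t0) := by field_simp
    have h3 : ν / φ t0 < (t0 + (ν / φ t0 + (1 - t0)) / 2 - t0) := by linarith
    calc ν = φ t0 * (ν / φ t0) := h2
      _ < _ := by exact mul_lt_mul_of_pos_left h3 hm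
  have hsub : ∀ x ∈ Icc t0 t1, x ∈ Ico (0:ℝ) 1 := fun x hx => ⟨ht0.1.trans hx.1, hx.2.trans_lt ht1⟩
  have hmono : MonotoneOn φ (Icc t0 t1) := by
    refine monotoneOn_of_hasDerivWithinAt_nonneg (f' := φ') (convex_Icc _ _)
      (fun x hx => (hd x (hsub x hx)).continuousAt.continuousWithinAt)
      (fun x hx => (hd x (hsub x (interior_subset hx))).hasDerivWithinAt) (fun x hx => ?_)
    have := hb x (hsub x (interior_subset hx))
    by_contra h
    push Not at h
    nlinarith [sq_nonneg (φ x)]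
  have hpos : ∀ x ∈ Icc t0 t1, 0 < φ x := fun x hx =>
    hm.trans_le (hmono ⟨le_rfl, h01.1.le⟩ hx hx.1)
  have hk : MonotoneOn (fun s => -(φ s)⁻¹ - s / ν) (Icc t0 t1) := by
    have hdk : ∀ x ∈ Icc t0 t1, HasDerivAt (fun s => -(φ s)⁻¹ - s / ν)
        (-(-φ' x / φ x ^ 2) - 1 / ν) x := fun x hx =>
      ((hd x (hsub x hx)).inv (hpos x hx).ne').neg.sub ((hasDerivAt_id x).div_const ν)
    refine monotoneOn_of_hasDerivWithinAt_nonneg (f' := fun x => (-(-φ' x / φ x ^ 2) - 1 / ν)) (convex_Icc _ _)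
      (fun x hx => (hdk x hx).continuousAt.continuousWithinAt)
      (fun x hx => (hdk x (interior_subset hx)).hasDerivWithinAt) (fun x hx => ?_)
    have h5 := hb x (hsub x (interior_subset hx))
    have h6 := hpos x (interior_subset hx)
    have : 1 / ν ≤ φ' x / φ x ^ 2 := by
      rw [div_le_div_iff₀ hν (by positivity)]; linarith
    have e : -(-φ' x / φ x ^ 2) = φ' x / φ x ^ 2 := by ring
    rw [e]; linarith
  have h7 := hk ⟨le_rfl, h01.1.le⟩ ⟨h01.1.le, le_rfl⟩ h01.1.le
  simp only at h7
  have h8 : 0 < (φ t1)⁻¹ := inv_pos.2 (hpos t1 ⟨h01.1.le, le_rfl⟩)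
  have h9 : (t1 - t0) / ν < (φ t0)⁻¹ := by rw [sub_div]; linarith
  rw [div_lt_iff₀ hν, ← div_eq_inv_mul, lt_div_iff₀ hm] at h9
  linarith [h01.2]

lemma oned_sc_eps {q q' : ℝ → ℝ} {b ε : ℝ} (hε : 0 < ε)
    (hd : ∀ t ∈ Ico (0:ℝ) b, HasDerivAt q (q' t) t)
    (hq : ∀ t ∈ Ico (0:ℝ) b, 0 ≤ q t)
    (hb : ∀ t ∈ Ico (0:ℝ) b, |q' t| ≤ 2 * √(q t) ^ 3) :
    ∀ t ∈ Ico (0:ℝ) b, |(√(q t + ε))⁻¹ - (√(q 0 + ε))⁻¹| ≤ t := by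
  intro t ht
  have h1 : ∀ x ∈ Ico (0:ℝ) b, HasDerivWithinAt (fun s => (√(q s + ε))⁻¹)
      (-(q' x / (2 * √(q x + ε))) / √(q x + ε) ^ 2) (Ico 0 b) x := by
    intro x hx
    have hp : 0 < q x + ε := by linarith [hq x hx]
    exact ((((hd x hx).add_const ε).sqrt hp.ne').inv (Real.sqrt_pos.2 hp).ne').hasDerivWithinAt
  have h2 : ∀ x ∈ Ico (0:ℝ) b, ‖-(q' x / (2 * √(q x + ε))) / √(q x + ε) ^ 2‖ ≤ 1 := by
    intro x hx
    have hp : 0 < √(q x + ε) := Real.sqrt_pos.2 (by linarith [hq x hx])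
    have e : -(q' x / (2 * √(q x + ε))) / √(q x + ε) ^ 2 = - (q' x / (2 * √(q x + ε) ^ 3)) := by
      field_simp
    rw [e, norm_neg, norm_div, Real.norm_eq_abs, Real.norm_eq_abs, abs_of_pos (a := 2 * _) (by positivity),
      div_le_one (by positivity)]
    refine (hb x hx).trans ?_
    gcongr
    linarith
  have := Convex.norm_image_sub_le_of_norm_hasDerivWithin_le h1 h2 (convex_Ico 0 b)
    (x := 0) (y := t) ⟨le_rfl, ht.1.trans_lt ht.2⟩ ht
  simpa [abs_of_nonneg ht.1] using this

lemma oned_sc {q q' : ℝ → ℝ} {b : ℝ}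
    (hd : ∀ t ∈ Ico (0:ℝ) b, HasDerivAt q (q' t) t)
    (hq : ∀ t ∈ Ico (0:ℝ) b, 0 ≤ q t)
    (hb : ∀ t ∈ Ico (0:ℝ) b, |q' t| ≤ 2 * √(q t) ^ 3) :
    ∀ t ∈ Ico (0:ℝ) b, √(q 0) ≤ √(q t) * (1 + t * √(q 0)) ∧
      √(q t) * (1 - t * √(q 0)) ≤ √(q 0) := by
  intro t ht
  have h0 : (0:ℝ) ∈ Ico 0 b := ⟨le_rfl, ht.1.trans_lt ht.2⟩
  have key : ∀ ε > 0, √(q 0 + ε) ≤ √(q t + ε) * (1 + t * √(q 0 + ε)) ∧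
      √(q t + ε) * (1 - t * √(q 0 + ε)) ≤ √(q 0 + ε) := by
    intro ε hε
    have h := oned_sc_eps hε hd hq hb t ht
    have hp : 0 < √(q t + ε) := Real.sqrt_pos.2 (by linarith [hq t ht])
    have hp0 : 0 < √(q 0 + ε) := Real.sqrt_pos.2 (by linarith [hq 0 h0])
    obtain ⟨h1, h2⟩ := abs_le.1 h
    generalize √(q t + ε) = x at *
    generalize √(q 0 + ε) = y at *
    constructor
    · have : x⁻¹ * (x * y) ≤ (y⁻¹ + t) * (x * y) := by gcongr; linarith
      have e1 : x⁻¹ * (x * y) = y := by field_simp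
      have e2 : (y⁻¹ + t) * (x * y) = x * (1 + t * y) := by field_simp
      linarith
    · have : y⁻¹ * (x * y) ≤ (x⁻¹ + t) * (x * y) := by gcongr; linarith
      have e1 : y⁻¹ * (x * y) = x := by field_simp
      have e2 : (x⁻¹ + t) * (x * y) = y + x * t * y := by field_simp
      linarith
  have lim : ∀ a : ℝ, Tendsto (fun ε => √(a + ε)) (𝓝[>] 0) (𝓝 √a) := by
    intro a
    have : Continuous (fun ε => √(a + ε)) := by fun_prop
    have := this.tendsto 0
    simp only [add_zero] at this
    exact this.mono_left nhdsWithin_le_nhds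
  constructor
  · refine le_of_tendsto_of_tendsto (lim (q 0))
      ((lim (q t)).mul (((lim (q 0)).const_mul t).const_add 1)) ?_
    filter_upwards [self_mem_nhdsWithin] with ε hε using (key ε hε).1
  · refine le_of_tendsto_of_tendsto 
      ((lim (q t)).mul (((lim (q 0)).const_mul t).const_sub 1)) (lim (q 0)) ?_
    filter_upwards [self_mem_nhdsWithin] with ε hε using (key ε hε).2

lemma line1 {n : ℕ} {f : (Fin n → ℝ) → ℝ} {x h : Fin n → ℝ} {t : ℝ}
    (hf : ContDiffAt ℝ 3 f (x + t • h)) :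
    HasDerivAt (fun s : ℝ => f (x + s • h)) (der1 f (x + t • h) h) t := by
  have h1 : HasFDerivAt f (fderiv ℝ f (x + t • h)) (x + t • h) :=
    (hf.differentiableAt (by norm_num)).hasFDerivAt
  have h2 : HasDerivAt (fun s : ℝ => x + s • h) h t := by
    simpa using ((hasDerivAt_id t).smul_const h).const_add x
  exact h1.comp_hasDerivAt t h2

lemma line2 {n : ℕ} {f : (Fin n → ℝ) → ℝ} {x h : Fin n → ℝ} {t : ℝ}
    (hf : ContDiffAt ℝ 3 f (x + t • h)) :
    HasDerivAt (fun s : ℝ => der1 f (x + s • h) h) (der2 f (x + t • h) h h) t := by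
  have h1 : HasFDerivAt (fderiv ℝ f) (fderiv ℝ (fderiv ℝ f) (x + t • h)) (x + t • h) :=
    ((hf.fderiv_right (m := 2) (by norm_num)).differentiableAt (by norm_num)).hasFDerivAt
  have h2 : HasDerivAt (fun s : ℝ => x + s • h) h t := by
    simpa using ((hasDerivAt_id t).smul_const h).const_add x
  have h3 := h1.comp_hasDerivAt t h2
  have h4 := h3.clm_apply (hasDerivAt_const t h)
  simp only [der1, der2, iteratedFDeriv_two_apply]
  simpa using h4

lemma line3 {n : ℕ} {f : (Fin n → ℝ) → ℝ} {x h : Fin n → ℝ} {t : ℝ}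
    (hf : ContDiffAt ℝ 3 f (x + t • h)) :
    HasDerivAt (fun s : ℝ => der2 f (x + s • h) h h) (der3 f (x + t • h) h) t := by
  have h1 := (hf.differentiableAt_iteratedFDeriv (m := 2) (by norm_num)).hasFDerivAt
  have h2 : HasDerivAt (fun s : ℝ => x + s • h) h t := by
    simpa using ((hasDerivAt_id t).smul_const h).const_add x
  have h3 := h1.comp_hasDerivAt t h2
  have h4 := (ContinuousMultilinearMap.apply ℝ (fun _ : Fin 2 => (Fin n → ℝ)) ℝ ![h, h]).hasFDerivAt.comp_hasDerivAt t h3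
  have e : der3 f (x + t • h) h = (fderiv ℝ (iteratedFDeriv ℝ 2 f) (x + t • h) h) ![h, h] := by
    unfold der3
    rw [iteratedFDeriv_succ_apply_left]
    rfl
  rw [e]
  exact h4

section scb
variable {n : ℕ} {K : Set (Fin n → ℝ)} {ψ : (Fin n → ℝ) → ℝ} {ν : ℝ}

lemma IsSCB.cda (hψ : IsSCB K ψ ν) {x : Fin n → ℝ} (hx : x ∈ interior K) : ContDiffAt ℝ 3 ψ x :=
  hψ.smooth.contDiffAt (isOpen_interior.mem_nhds hx)

lemma line_cont (x h : Fin n → ℝ) : Continuous (fun s : ℝ => x + s • h) := by fun_prop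

lemma IsSCB.d2_nonneg (hψ : IsSCB K ψ ν) {x : Fin n → ℝ} (hx : x ∈ interior K) (h : Fin n → ℝ) :
    0 ≤ der2 ψ x h h := by
  by_contra hcon
  push Not at hcon
  have hx' : x + (0:ℝ) • h ∈ interior K := by simpa using hx
  have h2 := line2 (f := ψ) (x := x) (h := h) (t := 0) (hψ.cda hx')
  have h3 := line3 (f := ψ) (x := x) (h := h) (t := 0) (hψ.cda hx')
  have ev1 : ∀ᶠ s in 𝓝 (0:ℝ), x + s • h ∈ interior K :=
    (line_cont x h).continuousAt.eventually (isOpen_interior.mem_nhds hx')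
  have ev2 : ∀ᶠ s in 𝓝 (0:ℝ), der2 ψ (x + s • h) h h < 0 :=
    h3.continuousAt.eventually (gt_mem_nhds (by simpa using hcon))
  have ev3 : (fun s : ℝ => der1 ψ (x + s • h) h) =ᶠ[𝓝 0] fun _ => (0:ℝ) := by
    filter_upwards [ev1, ev2] with s h1 h2
    have := hψ.gradBound _ h1 h
    rw [Real.sqrt_eq_zero_of_nonpos h2.le, mul_zero] at this
    exact abs_eq_zero.1 (le_antisymm this (abs_nonneg _))
  have := h2.unique ((hasDerivAt_const (0:ℝ) (0:ℝ)).congr_of_eventuallyEq ev3)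
  simp at this
  linarith

lemma seg_int (hK : Convex ℝ K) {w u : Fin n → ℝ} (hw : w ∈ interior K) (hu : u ∈ K) {t : ℝ}
    (ht : t ∈ Ico (0:ℝ) 1) : w + t • (u - w) ∈ interior K := by
  have := hK.add_smul_sub_mem_interior hu hw (t := 1 - t) ⟨by linarith [ht.2], by linarith [ht.1]⟩
  convert this using 1
  ext i; simp; ring

lemma d1_smul (f : (Fin n → ℝ) → ℝ) (x h : Fin n → ℝ) (c : ℝ) : der1 f x (c • h) = c * der1 f x h := by
  simp [der1]
lemma d1_add (f : (Fin n → ℝ) → ℝ) (x h g : Fin n → ℝ) : der1 f x (h + g) = der1 f x h + der1 f x g := by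
  simp [der1]
lemma d1_sub (f : (Fin n → ℝ) → ℝ) (x h g : Fin n → ℝ) : der1 f x (h - g) = der1 f x h - der1 f x g := by
  simp [der1]
lemma d2_smul (f : (Fin n → ℝ) → ℝ) (x h : Fin n → ℝ) (c : ℝ) :
    der2 f x (c • h) (c • h) = c ^ 2 * der2 f x h h := by
  simp [der2, iteratedFDeriv_two_apply]; ring
lemma d2_par (f : (Fin n → ℝ) → ℝ) (x h g : Fin n → ℝ) :
    der2 f x (h + g) (h + g) + der2 f x (h - g) (h - g) = 2 * der2 f x h h + 2 * der2 f x g g := by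
  simp [der2, iteratedFDeriv_two_apply]; ring

/-- the barrier inequality along a segment -/
lemma IsSCB.bar (hψ : IsSCB K ψ ν) (hν : 1 ≤ ν) (hK : Convex ℝ K) {w u : Fin n → ℝ}
    (hw : w ∈ interior K) (hu : u ∈ K) :
    ∀ t ∈ Ico (0:ℝ) 1, der1 ψ (w + t • (u - w)) (u - w) * (1 - t) ≤ ν := by
  refine oned_barrier (φ := fun t => der1 ψ (w + t • (u - w)) (u - w)) (by linarith)
    (fun t ht => line2 (hψ.cda (seg_int hK hw hu ht))) (fun t ht => ?_)
  have hi := seg_int hK hw hu ht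
  have h1 := hψ.gradBound _ hi (u - w)
  have h2 := hψ.d2_nonneg hi (u - w)
  rw [← Real.sqrt_mul (by linarith)] at h1
  have h3 := Real.sq_sqrt (show 0 ≤ ν * der2 ψ (w + t • (u - w)) (u - w) (u - w) by nlinarith)
  rw [← h3, ← sq_abs]
  gcongr

/-- second derivative control along a line -/
lemma IsSCB.sc (hψ : IsSCB K ψ ν) {w h : Fin n → ℝ} {b : ℝ}
    (hi : ∀ t ∈ Ico (0:ℝ) b, w + t • h ∈ interior K) :
    ∀ t ∈ Ico (0:ℝ) b, √(der2 ψ w h h) ≤ √(der2 ψ (w + t • h) h h) * (1 + t * √(der2 ψ w h h)) ∧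
      √(der2 ψ (w + t • h) h h) * (1 - t * √(der2 ψ w h h)) ≤ √(der2 ψ w h h) := by
  have := oned_sc (q := fun t => der2 ψ (w + t • h) h h) (b := b)
    (fun t ht => line3 (hψ.cda (hi t ht))) (fun t ht => hψ.d2_nonneg (hi t ht) h)
    (fun t ht => hψ.selfConc _ (hi t ht) h)
  simpa using this

lemma IsSCB.d1_lower (hψ : IsSCB K ψ ν) {w h : Fin n → ℝ} {b : ℝ}
    (hi : ∀ t ∈ Ico (0:ℝ) b, w + t • h ∈ interior K) :
    ∀ t ∈ Ico (0:ℝ) b, der1 ψ w h + der2 ψ w h h * t / (1 + t * √(der2 ψ w h h)) ≤ der1 ψ (w + t • h) h := by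
  intro t ht
  have h0 : (0:ℝ) ∈ Ico 0 b := ⟨le_rfl, ht.1.trans_lt ht.2⟩
  have hw : w ∈ interior K := by simpa using hi 0 h0
  set N := √(der2 ψ w h h) with hN
  have hN0 : 0 ≤ N := Real.sqrt_nonneg _
  have hNs : N ^ 2 = der2 ψ w h h := Real.sq_sqrt (hψ.d2_nonneg hw h)
  have hmono : MonotoneOn (fun s => der1 ψ (w + s • h) h - N ^ 2 * s / (1 + s * N)) (Ico 0 b) := by
    have hd : ∀ x ∈ Ico (0:ℝ) b, HasDerivAt (fun s => der1 ψ (w + s • h) h - N ^ 2 * s / (1 + s * N))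
        (der2 ψ (w + x • h) h h - ((N ^ 2 * 1) * (1 + x * N) - N ^ 2 * x * (1 * N)) / (1 + x * N) ^ 2) x := by
      intro x hx
      have hp : 0 < 1 + x * N := by have := hx.1; positivity
      exact (line2 (hψ.cda (hi x hx))).sub
        (((hasDerivAt_id x).const_mul (N ^ 2)).div (((hasDerivAt_id x).mul_const N).const_add 1) hp.ne')
    refine monotoneOn_of_hasDerivWithinAt_nonneg (f' := fun x => der2 ψ (w + x • h) h h - ((N ^ 2 * 1) * (1 + x * N) - N ^ 2 * x * (1 * N)) / (1 + x * N) ^ 2) (convex_Ico _ _)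
      (fun x hx => (hd x hx).continuousAt.continuousWithinAt)
      (fun x hx => (hd x (interior_subset hx)).hasDerivWithinAt) (fun x hx => ?_)
    have hx' := interior_subset hx
    have hp : 0 < 1 + x * N := by have := hx'.1; positivity
    have h1 := (hψ.sc hi x hx').1
    have h2 := hψ.d2_nonneg (hi x hx') h
    rw [sub_nonneg, div_le_iff₀ (by positivity)]
    have h3 : N ^ 2 ≤ (√(der2 ψ (w + x • h) h h) * (1 + x * N)) ^ 2 := by gcongr
    rw [mul_pow, Real.sq_sqrt h2] at h3
    linarith
  have := hmono h0 ht ht.1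
  simp at this
  rw [← hNs]; linarith

/-- key inequality -/
lemma IsSCB.key (hψ : IsSCB K ψ ν) (hν : 1 ≤ ν) (hK : Convex ℝ K) {w u : Fin n → ℝ}
    (hw : w ∈ interior K) (hu : u ∈ K) :
    der1 ψ w (u - w) ≤ ν ∧ √(der2 ψ w (u - w) (u - w)) ≤ 2 * ν - der1 ψ w (u - w) + 2 := by
  have h0 := hψ.bar hν hK hw hu 0 (by simp)
  have h1 := hψ.bar hν hK hw hu (1/2) (by norm_num)
  have h2 := hψ.d1_lower (w := w) (h := u - w) (b := 1) (fun t ht => seg_int hK hw hu ht) (1/2) (by norm_num)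
  simp at h0
  refine ⟨h0, ?_⟩
  have hs := Real.sq_sqrt (hψ.d2_nonneg hw (u - w))
  have hN := Real.sqrt_nonneg (der2 ψ w (u - w) (u - w))
  rw [← hs] at h2
  rw [Real.sqrt_sq hN] at h2
  set N := √(der2 ψ w (u - w) (u - w))
  have : N - 2 ≤ N ^ 2 * (1/2) / (1 + 1/2 * N) := by
    rw [le_div_iff₀ (by positivity)]; nlinarith
  linarith

lemma IsSCB.growth (hψ : IsSCB K ψ ν) (hν : 1 ≤ ν) (hK : Convex ℝ K) {w u : Fin n → ℝ}
    (hw : w ∈ interior K) (hu : u ∈ K) {t : ℝ} (ht : t ∈ Ico (0:ℝ) 1) :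
    ψ (w + t • (u - w)) ≤ ψ w - ν * Real.log (1 - t) := by
  have hmono : MonotoneOn (fun s => -ψ (w + s • (u - w)) - ν * Real.log (1 - s)) (Ico 0 1) := by
    have hd : ∀ x ∈ Ico (0:ℝ) 1, HasDerivAt (fun s => -ψ (w + s • (u - w)) - ν * Real.log (1 - s))
        (- der1 ψ (w + x • (u - w)) (u - w) - ν * (-1 / (1 - x))) x := by
      intro x hx
      have hp : 0 < 1 - x := by linarith [hx.2]
      exact (line1 (hψ.cda (seg_int hK hw hu hx))).neg.sub
        ((((hasDerivAt_id x).const_sub 1).log hp.ne').const_mul ν)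
    refine monotoneOn_of_hasDerivWithinAt_nonneg (f' := fun x => (- der1 ψ (w + x • (u - w)) (u - w) - ν * (-1 / (1 - x)))) (convex_Ico _ _)
      (fun x hx => (hd x hx).continuousAt.continuousWithinAt)
      (fun x hx => (hd x (interior_subset hx)).hasDerivWithinAt) (fun x hx => ?_)
    have hx' := interior_subset hx
    have hp : 0 < 1 - x := by linarith [hx'.2]
    have h1 := hψ.bar hν hK hw hu x hx'
    have : der1 ψ (w + x • (u - w)) (u - w) ≤ ν / (1 - x) := by rwa [le_div_iff₀ hp]
    have e : ν * (-1 / (1 - x)) = - (ν / (1 - x)) := by ring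
    simp only [e]; linarith
  have := hmono (a := 0) (b := t) (by simp) ht ht.1
  simp at this
  linarith

/-- Bregman lower bound -/
lemma IsSCB.breg_lower (hψ : IsSCB K ψ ν) (hK : Convex ℝ K) {w u : Fin n → ℝ}
    (hw : w ∈ interior K) (hu : u ∈ interior K) :
    der2 ψ w (u - w) (u - w) / (2 * (1 + √(der2 ψ w (u - w) (u - w)))) ≤
      ψ u - ψ w - der1 ψ w (u - w) := by
  set h := u - w with hh
  set N := √(der2 ψ w h h) with hN
  have hN0 : 0 ≤ N := Real.sqrt_nonneg _
  have hq := hψ.d2_nonneg hw h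
  have hi : ∀ t ∈ Icc (0:ℝ) 1, w + t • h ∈ interior K := by
    intro t ht
    rcases ht.2.lt_or_eq with h1 | h1
    · exact seg_int hK hw (interior_subset hu) ⟨ht.1, h1⟩
    · rw [h1, one_smul, hh]; simpa using hu
  have hi' : ∀ t ∈ Ico (0:ℝ) 1, w + t • h ∈ interior K := fun t ht => hi t ⟨ht.1, ht.2.le⟩
  have hmono : MonotoneOn (fun s => ψ (w + s • h) - s * der1 ψ w h - der2 ψ w h h / (2 * (1 + N)) * s ^ 2) (Icc 0 1) := by
    have hd : ∀ x ∈ Icc (0:ℝ) 1, HasDerivAt (fun s => ψ (w + s • h) - s * der1 ψ w h - der2 ψ w h h / (2 * (1 + N)) * s ^ 2)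
        (der1 ψ (w + x • h) h - 1 * der1 ψ w h - der2 ψ w h h / (2 * (1 + N)) * (2 * x)) x := by
      intro x hx
      refine ((line1 (hψ.cda (hi x hx))).sub ((hasDerivAt_id x).mul_const _)).sub (HasDerivAt.const_mul _ ?_)
      simpa using hasDerivAt_pow 2 x
    refine monotoneOn_of_hasDerivWithinAt_nonneg (f' := fun x => (der1 ψ (w + x • h) h - 1 * der1 ψ w h - der2 ψ w h h / (2 * (1 + N)) * (2 * x))) (convex_Icc _ _)
      (fun x hx => (hd x hx).continuousAt.continuousWithinAt)
      (fun x hx => (hd x (interior_subset hx)).hasDerivWithinAt) (fun x hx => ?_)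
    rw [interior_Icc] at hx
    have h1 := hψ.d1_lower hi' x ⟨hx.1.le, hx.2⟩
    have hx0 := hx.1
    have hx1 := hx.2
    have h2 : der2 ψ w h h * x / (1 + N) ≤ der2 ψ w h h * x / (1 + x * N) := by
      gcongr
      nlinarith
    have e : der2 ψ w h h / (2 * (1 + N)) * (2 * x) = der2 ψ w h h * x / (1 + N) := by
      field_simp
    simp only [e]; linarith
  have := hmono (a := 0) (b := 1) (by simp) (by simp) (by norm_num)
  simp at this
  have e : w + h = u := by simp [hh]
  rw [e] at this
  linarith

/-- Dikin ellipsoid -/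
lemma IsSCB.dikin (hψ : IsSCB K ψ ν) (hK : Convex ℝ K) (hKc : IsClosed K) {w h : Fin n → ℝ}
    (hw : w ∈ interior K) (hh : √(der2 ψ w h h) ≤ 1/2) : w + h ∈ K := by
  by_contra hcon
  set A : Set ℝ := {t | t ∈ Icc (0:ℝ) 1 ∧ w + t • h ∈ K} with hA
  have hAc : IsClosed A := by
    refine isClosed_Icc.inter (hKc.preimage (line_cont w h))
  have hA0 : (0:ℝ) ∈ A := by simp [hA, interior_subset hw]
  have hbdd : BddAbove A := ⟨1, fun t ht => ht.1.2⟩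
  set b := sSup A with hb
  have hbA : b ∈ A := hAc.csSup_mem ⟨0, hA0⟩ hbdd
  have hb0 : 0 ≤ b := hbA.1.1
  have hb1 : b < 1 := lt_of_le_of_ne hbA.1.2 (fun h1 => hcon (by have := hbA.2; rw [h1] at this; simpa using this))
  have hnint : w + b • h ∉ interior K := by
    intro hi
    have ev : ∀ᶠ s in 𝓝 b, w + s • h ∈ interior K :=
      (line_cont w h).continuousAt.eventually (isOpen_interior.mem_nhds hi)
    have ev2 : ∀ᶠ s in 𝓝[>] b, s ∈ A := by
      filter_upwards [nhdsWithin_le_nhds ev, nhdsWithin_le_nhds (gt_mem_nhds hb1), self_mem_nhdsWithin] with s h1 h2 h3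
      exact ⟨⟨hb0.trans (le_of_lt h3), h2.le⟩, interior_subset h1⟩
    obtain ⟨s, hs1, hs2⟩ := (ev2.and self_mem_nhdsWithin).exists
    exact absurd (le_csSup hbdd hs1) (not_le.2 hs2)
  have hbpos : 0 < b := lt_of_le_of_ne hb0 (fun h1 => hnint (by rw [← h1]; simpa using hw))
  have hi : ∀ t ∈ Ico (0:ℝ) b, w + t • h ∈ interior K := by
    intro t ht
    have := seg_int hK hw hbA.2 (t := t / b) ⟨div_nonneg ht.1 hb0, (div_lt_one hbpos).2 ht.2⟩
    convert this using 2
    rw [add_sub_cancel_left, smul_smul, div_mul_cancel₀ _ hbpos.ne']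
  have hfr : w + b • h ∈ frontier K := by
    rw [hKc.frontier_eq]; exact ⟨hbA.2, hnint⟩
  have hd2 : ∀ t ∈ Ico (0:ℝ) b, der2 ψ (w + t • h) h h ≤ 1 := by
    intro t ht
    have h1 := (hψ.sc hi t ht).2
    have h2 := Real.sqrt_nonneg (der2 ψ (w + t • h) h h)
    have h3 := Real.sqrt_nonneg (der2 ψ w h h)
    have h4 : √(der2 ψ (w + t • h) h h) ≤ 1 := by
      have : t * √(der2 ψ w h h) ≤ 1/2 := by
        have := ht.1; have := ht.2; nlinarith
      nlinarith
    rwa [Real.sqrt_le_one] at h4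
  have hd1 : ∀ t ∈ Ico (0:ℝ) b, der1 ψ (w + t • h) h ≤ der1 ψ w h + 1 := by
    intro t ht
    have := Convex.image_sub_le_mul_sub_of_deriv_le (D := Ico 0 b) (f := fun s => der1 ψ (w + s • h) h) (C := 1) (convex_Ico 0 b)
      (fun x hx => (line2 (hψ.cda (hi x hx))).continuousAt.continuousWithinAt)
      (fun x hx => (line2 (hψ.cda (hi x (interior_subset hx)))).differentiableAt.differentiableWithinAt)
      (fun x hx => by rw [(line2 (hψ.cda (hi x (interior_subset hx)))).deriv]; exact hd2 x (interior_subset hx))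
      0 ⟨le_rfl, hbpos⟩ t ht ht.1
    simp at this
    linarith [ht.2]
  have hd0 : ∀ t ∈ Ico (0:ℝ) b, ψ (w + t • h) ≤ ψ w + |der1 ψ w h + 1| := by
    intro t ht
    have := Convex.image_sub_le_mul_sub_of_deriv_le (D := Ico 0 b) (f := fun s => ψ (w + s • h)) (C := |der1 ψ w h + 1|) (convex_Ico 0 b)
      (fun x hx => (line1 (hψ.cda (hi x hx))).continuousAt.continuousWithinAt)
      (fun x hx => (line1 (hψ.cda (hi x (interior_subset hx)))).differentiableAt.differentiableWithinAt)
      (fun x hx => by rw [(line1 (hψ.cda (hi x (interior_subset hx)))).deriv]; exact (hd1 x (interior_subset hx)).trans (le_abs_self _))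
      0 ⟨le_rfl, hbpos⟩ t ht ht.1
    simp at this
    have h5 : |der1 ψ w h + 1| * t ≤ |der1 ψ w h + 1| := mul_le_of_le_one_right (abs_nonneg _) (by linarith [ht.2])
    linarith
  have hIco : Ico 0 b ∈ 𝓝[<] b := Ico_mem_nhdsLT hbpos
  have htend : Tendsto (fun s : ℝ => w + s • h) (𝓝[<] b) (𝓝[interior K] (w + b • h)) := by
    refine tendsto_nhdsWithin_iff.2 ⟨(line_cont w h).continuousAt.tendsto.mono_left nhdsWithin_le_nhds, ?_⟩
    filter_upwards [hIco] with s hs using hi s hs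
  have hbl := (hψ.blowup _ hfr).comp htend
  have := hbl.eventually (eventually_gt_atTop (ψ w + |der1 ψ w h + 1|))
  obtain ⟨s, hs1, hs2⟩ := (this.and (show ∀ᶠ s in 𝓝[<] b, s ∈ Ico 0 b from hIco)).exists
  exact absurd (hd0 s hs2) (not_le.2 hs1)

end scb
end AB
section CC
open Set Filter Topology

section lifted
variable {d : ℕ} {K : Set (Fin d → ℝ)} {ψ : (Fin d → ℝ) → ℝ} {ν : ℝ}

lemma dotp_eq {n : ℕ} (x y : Fin n → ℝ) : dotp x y = x ⬝ᵥ y := rfl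

lemma dotp_gradv {n : ℕ} (f : (Fin n → ℝ) → ℝ) (x y : Fin n → ℝ) :
    dotp (gradv f x) y = der1 f x y := by
  have e : y = ∑ i, y i • (Pi.single i (1:ℝ) : Fin n → ℝ) := by
    rw [pi_eq_sum_univ' y]; 
    ext j; simp [Finset.sum_apply, Pi.single_apply]
  unfold dotp gradv der1
  conv_rhs => rw [e]
  simp [map_sum, mul_comm]

lemma dotp_hess {n : ℕ} (f : (Fin n → ℝ) → ℝ) (x p : Fin n → ℝ) :
    dotp p ((hess f x).mulVec p) = der2 f x p p := by
  have e : p = ∑ i, p i • (Pi.single i (1:ℝ) : Fin n → ℝ) := by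
    ext j; simp [Finset.sum_apply, Pi.single_apply]
  simp only [dotp, hess, der2, iteratedFDeriv_two_apply, Matrix.mulVec, dotProduct, Matrix.of_apply]
  simp only [Matrix.cons_val_zero, Matrix.cons_val_one]
  conv_rhs => rw [e]
  simp only [map_sum, map_smul, _root_.sum_apply, _root_.smul_apply, smul_eq_mul, Finset.mul_sum]
  conv_rhs => rw [Finset.sum_comm]
  refine Finset.sum_congr rfl fun i _ => Finset.sum_congr rfl fun j _ => ?_
  ring

lemma liftv_last (w : Fin d → ℝ) : liftv w (Fin.last d) = 1 := by simp [liftv]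
lemma liftv_cast (w : Fin d → ℝ) (i : Fin d) : liftv w i.castSucc = w i := by simp [liftv]

lemma lift_val (w : Fin d → ℝ) : liftedBarrier ψ ν (liftv w) = 400 * ψ w := by
  simp [liftedBarrier, liftv]

lemma lift_cda (hψ : IsSCB K ψ ν) {x : Fin (d+1) → ℝ} (hx : x (Fin.last d) ≠ 0)
    (hi : (fun i : Fin d => x i.castSucc / x (Fin.last d)) ∈ interior K) :
    ContDiffAt ℝ 3 (liftedBarrier ψ ν) x := by
  have h1 : ContDiffAt ℝ 3 (fun y : Fin (d+1) → ℝ => (fun i : Fin d => y i.castSucc / y (Fin.last d))) x := by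
    refine contDiffAt_pi.2 fun i => ContDiffAt.div ?_ ?_ hx
    · exact (contDiff_apply ℝ ℝ i.castSucc).contDiffAt
    · exact (contDiff_apply ℝ ℝ (Fin.last d)).contDiffAt
  have h2 := ContDiffAt.comp (g := ψ) x (hψ.cda hi) h1
  have h3 : ContDiffAt ℝ 3 (fun y : Fin (d+1) → ℝ => Real.log (y (Fin.last d))) x :=
    ContDiffAt.log (contDiff_apply ℝ ℝ (Fin.last d)).contDiffAt hx
  exact contDiffAt_const.mul (h2.sub (contDiffAt_const.mul h3))

/-- horizontal part of a direction -/
noncomputable def gdir (w : Fin d → ℝ) (p : Fin (d+1) → ℝ) : Fin d → ℝ :=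
  fun i => p i.castSucc - p (Fin.last d) * w i

lemma lift_line (w : Fin d → ℝ) (p : Fin (d+1) → ℝ) {t : ℝ} (ht : 1 + t * p (Fin.last d) ≠ 0) :
    (fun i : Fin d => (liftv w + t • p) i.castSucc / (liftv w + t • p) (Fin.last d)) =
      w + (t / (1 + t * p (Fin.last d))) • gdir w p := by
  ext i
  simp only [Pi.add_apply, Pi.smul_apply, liftv_last, liftv_cast, smul_eq_mul, gdir]
  field_simp
  ring

lemma lift_ders (hψ : IsSCB K ψ ν) {w : Fin d → ℝ} (hw : w ∈ interior K) (p : Fin (d+1) → ℝ) :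
    der1 (liftedBarrier ψ ν) (liftv w) p =
      400 * (der1 ψ w (gdir w p) - 2 * ν * p (Fin.last d)) ∧
    der2 (liftedBarrier ψ ν) (liftv w) p p =
      400 * (der2 ψ w (gdir w p) (gdir w p) - 2 * p (Fin.last d) * der1 ψ w (gdir w p)
        + 2 * ν * p (Fin.last d) ^ 2) := by
  set β := p (Fin.last d) with hβ
  set g := gdir w p with hg
  have ev0 : ∀ᶠ t in 𝓝 (0:ℝ), 1 + t * β ≠ 0 := by
    have : ContinuousAt (fun t : ℝ => 1 + t * β) 0 := by fun_prop
    exact this.eventually_ne (by simp)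
  have ev1 : ∀ᶠ t in 𝓝 (0:ℝ), w + (t / (1 + t * β)) • g ∈ interior K := by
    have : ContinuousAt (fun t : ℝ => w + (t / (1 + t * β)) • g) 0 := by
      refine continuousAt_const.add (ContinuousAt.smul (ContinuousAt.div continuousAt_id (by fun_prop) (by simp)) continuousAt_const)
    exact this.eventually (isOpen_interior.mem_nhds (by simpa using hw))
  have ev2 : ∀ᶠ t in 𝓝 (0:ℝ), ContDiffAt ℝ 3 (liftedBarrier ψ ν) (liftv w + t • p) := by
    filter_upwards [ev0, ev1] with t h0 h1
    refine lift_cda hψ ?_ ?_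
    · simpa [liftv_last] using h0
    · rw [lift_line w p h0]; exact h1
  have evF : ∀ᶠ t in 𝓝 (0:ℝ), liftedBarrier ψ ν (liftv w + t • p) =
      400 * (ψ (w + (t / (1 + t * β)) • g) - 2 * ν * Real.log (1 + t * β)) := by
    filter_upwards [ev0] with t h0
    unfold liftedBarrier
    rw [lift_line w p h0]
    simp [liftv_last, hβ, hg]
  have hσ : ∀ t : ℝ, 1 + t * β ≠ 0 → HasDerivAt (fun t => t / (1 + t * β)) (1 / (1 + t * β) ^ 2) t := by
    intro t ht
    have := (hasDerivAt_id t).div (((hasDerivAt_id t).mul_const β).const_add 1) ht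
    refine this.congr_deriv ?_
    simp only [id]
    congr 1
    ring
  have ev3 : ∀ᶠ t in 𝓝 (0:ℝ), der1 (liftedBarrier ψ ν) (liftv w + t • p) p =
      400 * (der1 ψ (w + (t / (1 + t * β)) • g) g * (1 / (1 + t * β) ^ 2) - 2 * ν * (β / (1 + t * β))) := by
    filter_upwards [ev0, ev1, ev2, evF.eventually_nhds] with t h0 h1 h2 h3
    have a1 := line1 h2
    have a2 := HasDerivAt.comp (h₂ := fun s : ℝ => ψ (w + s • g)) (h := fun t => t / (1 + t * β)) t
      (line1 (f := ψ) (x := w) (h := g) (t := t / (1 + t * β)) (hψ.cda h1)) (hσ t h0)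
    have a3 := (((hasDerivAt_id t).mul_const β).const_add 1).log h0
    have a4 := (a2.sub (a3.const_mul (2 * ν))).const_mul 400
    have := a1.unique (HasDerivAt.congr_of_eventuallyEq a4 h3)
    simpa using this
  have h00 : (1:ℝ) + 0 * β ≠ 0 := by simp
  have e1 := ev3.self_of_nhds
  constructor
  · simpa using e1
  · have b1 := line2 ev2.self_of_nhds
    have b2 := HasDerivAt.comp (h₂ := fun s : ℝ => der1 ψ (w + s • g) g) (h := fun t => t / (1 + t * β)) 0
      (line2 (f := ψ) (x := w) (h := g) (t := 0 / (1 + 0 * β)) (hψ.cda (by simpa using hw))) (hσ 0 h00)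
    have b3 : HasDerivAt (fun t : ℝ => 1 + t * β) β 0 := by
      simpa using ((hasDerivAt_id (0:ℝ)).mul_const β).const_add 1
    have b4 := (hasDerivAt_const (0:ℝ) (1:ℝ)).div (b3.pow 2) (by simp)
    have b5 := ((hasDerivAt_const (0:ℝ) β).div b3 h00).const_mul (2 * ν)
    have b6 := ((b2.mul b4).sub b5).const_mul 400
    have := b1.unique (HasDerivAt.congr_of_eventuallyEq b6 ev3)
    simp at this
    rw [this]
    ring

/-- a boundary point has zero Hessian -/
lemma hess_bdry (hψ : IsSCB K ψ ν) (hK : Convex ℝ K) (hKc : IsClosed K) {v w0 : Fin d → ℝ}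
    (hv : v ∈ K) (hv' : v ∉ interior K) (hw0 : w0 ∈ interior K) :
    hess (liftedBarrier ψ ν) (liftv v) = 0 := by
  have hnd : ¬ DifferentiableAt ℝ (fderiv ℝ (liftedBarrier ψ ν)) (liftv v) := by
    intro hd
    set Ψ := liftedBarrier ψ ν
    set p : Fin (d+1) → ℝ := Fin.snoc (w0 - v) 0 with hp
    have hplast : p (Fin.last d) = 0 := by simp [hp]
    have hline : ∀ s : ℝ, liftv v + s • p = liftv (v + s • (w0 - v)) := by
      intro s
      ext i
      refine Fin.lastCases ?_ (fun j => ?_) i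
      · simp [liftv_last, hp]
      · simp [liftv_cast, hp]
    have hint : ∀ s ∈ Ioc (0:ℝ) 1, v + s • (w0 - v) ∈ interior K := fun s hs =>
      hK.add_smul_sub_mem_interior hv hw0 hs
    have hcont : ContinuousAt (fun s : ℝ => fderiv ℝ Ψ (liftv v + s • p) p) 0 := by
      have h1 : ContinuousAt (fderiv ℝ Ψ) (liftv v + (0:ℝ) • p) := by simpa using hd.continuousAt
      have h2 : ContinuousAt (fun s : ℝ => fderiv ℝ Ψ (liftv v + s • p)) 0 :=
        ContinuousAt.comp (f := fun s : ℝ => liftv v + s • p) h1 (line_cont _ _).continuousAt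
      exact h2.clm_apply continuousAt_const
    set M := |fderiv ℝ Ψ (liftv v + (0:ℝ) • p) p| + 1 with hM
    have ev : ∀ᶠ s in 𝓝 (0:ℝ), |fderiv ℝ Ψ (liftv v + s • p) p| < M :=
      hcont.abs.eventually (gt_mem_nhds (by simp [hM]))
    obtain ⟨δ, hδ, hball⟩ := Metric.eventually_nhds_iff.1 ev
    set b := min (δ / 2) 1 with hb
    have hb0 : 0 < b := by positivity
    have hsub : ∀ s ∈ Ioc (0:ℝ) b, s ∈ Ioc (0:ℝ) 1 := fun s hs => ⟨hs.1, hs.2.trans (min_le_right _ _)⟩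
    have hder : ∀ s ∈ Ioc (0:ℝ) b, HasDerivAt (fun s : ℝ => Ψ (liftv v + s • p)) (fderiv ℝ Ψ (liftv v + s • p) p) s := by
      intro s hs
      refine line1 (lift_cda hψ ?_ ?_)
      · simp [liftv_last, hplast]
      · have h1 : (1:ℝ) + s * p (Fin.last d) ≠ 0 := by simp [hplast]
        rw [hline]
        simp only [liftv_last, liftv_cast, div_one]
        exact hint s (hsub s hs)
    have hbound : ∀ s ∈ Ioc (0:ℝ) b, 400 * ψ (v + s • (w0 - v)) ≤ 400 * ψ (v + b • (w0 - v)) + M * b := by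
      intro s hs
      have := Convex.norm_image_sub_le_of_norm_hasDerivWithin_le (s := Ioc (0:ℝ) b) (C := M)
        (fun x hx => (hder x hx).hasDerivWithinAt) (fun x hx => ?_) (convex_Ioc 0 b) (x := s) (y := b) hs ⟨hb0, le_rfl⟩
      · simp only [hline, Real.norm_eq_abs] at this
        rw [show Ψ = liftedBarrier ψ ν from rfl, lift_val, lift_val] at this
        have h1 := neg_le_of_abs_le this
        rw [abs_of_nonneg (by linarith [hs.2])] at h1
        have hM0 : 0 ≤ M := by positivity
        nlinarith [hs.1]
      · refine le_of_lt (hball ?_)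
        rw [Real.dist_eq, sub_zero, abs_of_pos hx.1]
        have := min_le_left (δ/2) 1
        linarith [hx.2]
    have hfr : v ∈ frontier K := by
      rw [hKc.frontier_eq]; exact ⟨hv, hv'⟩
    have hI : Ioc 0 b ∈ 𝓝[>] (0:ℝ) := Ioc_mem_nhdsGT hb0
    have htend : Tendsto (fun s : ℝ => v + s • (w0 - v)) (𝓝[>] 0) (𝓝[interior K] v) := by
      refine tendsto_nhdsWithin_iff.2 ⟨?_, ?_⟩
      · have := (line_cont v (w0 - v)).tendsto 0
        simp only [zero_smul, add_zero] at this
        exact this.mono_left nhdsWithin_le_nhds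
      · filter_upwards [hI] with s hs using hint s (hsub s hs)
    have hbl := (hψ.blowup _ hfr).comp htend
    have := hbl.eventually (eventually_gt_atTop ((400 * ψ (v + b • (w0 - v)) + M * b) / 400))
    obtain ⟨s, hs1, hs2⟩ := (this.and (show ∀ᶠ s in 𝓝[>] (0:ℝ), s ∈ Ioc 0 b from hI)).exists
    have h2 := hbound s hs2
    have h3 : (400 * ψ (v + b • (w0 - v)) + M * b) / 400 < ψ (v + s • (w0 - v)) := hs1
    rw [div_lt_iff₀ (by norm_num)] at h3
    linarith
  ext i j
  simp [hess, der2, iteratedFDeriv_two_apply, fderiv_zero_of_not_differentiableAt hnd]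

end lifted

section scb2
variable {n : ℕ} {K : Set (Fin n → ℝ)} {ψ : (Fin n → ℝ) → ℝ} {ν : ℝ}

lemma IsSCB.sym_bound (hψ : IsSCB K ψ ν) (hν : 1 ≤ ν) (hK : Convex ℝ K) {w e : Fin n → ℝ}
    (hw : w ∈ interior K) (h1 : w + e ∈ K) (h2 : w - e ∈ K) :
    der2 ψ w e e ≤ (4 * ν) ^ 2 := by
  have hq := hψ.d2_nonneg hw e
  have hs : √(der2 ψ w e e) ≤ 4 * ν := by
    rcases le_total 0 (der1 ψ w e) with h | h
    · have := (hψ.key hν hK hw h1).2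
      rw [add_sub_cancel_left] at this
      linarith
    · have := (hψ.key hν hK hw h2).2
      have e1 : w - e - w = (-1 : ℝ) • e := by ext i; simp
      rw [e1, d2_smul, d1_smul] at this
      norm_num at this
      linarith
  calc der2 ψ w e e = √(der2 ψ w e e) ^ 2 := (Real.sq_sqrt hq).symm
    _ ≤ _ := by gcongr

lemma IsSCB.compare (hψ : IsSCB K ψ ν) (hν : 1 ≤ ν) (hK : Convex ℝ K) (hKc : IsClosed K)
    {w1 v g : Fin n → ℝ} (hw1 : w1 ∈ interior K) (hv : v ∈ K) {T : ℝ} (hT : 2 ≤ T)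
    (hw : w1 + (1 - 1 / T) • (v - w1) ∈ interior K) :
    der2 ψ (w1 + (1 - 1 / T) • (v - w1)) g g ≤ (8 * ν * T) ^ 2 * der2 ψ w1 g g ∧
    der2 ψ (w1 + (1 - 1 / T) • (v - w1)) (w1 - (w1 + (1 - 1 / T) • (v - w1)))
      (w1 - (w1 + (1 - 1 / T) • (v - w1))) ≤ (4 * ν * T) ^ 2 := by
  have hT0 : 0 < T := by linarith
  set w := w1 + (1 - 1 / T) • (v - w1) with hwdef
  have hw1K := interior_subset hw1
  have hq1 := hψ.d2_nonneg hw1 g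
  constructor
  · have key : ∀ r : ℝ, 0 < r → der2 ψ w1 g g ≤ r ^ 2 → der2 ψ w g g ≤ (8 * ν * T) ^ 2 * r ^ 2 := by
      intro r hr hle
      have hd : ∀ c : ℝ, c ^ 2 = (1 / (2 * r)) ^ 2 → w1 + c • g ∈ K := by
        intro c hc
        refine hψ.dikin hK hKc hw1 ?_
        rw [d2_smul, hc]
        refine Real.sqrt_le_iff.2 ⟨by norm_num, ?_⟩
        calc (1 / (2 * r)) ^ 2 * der2 ψ w1 g g ≤ (1 / (2 * r)) ^ 2 * r ^ 2 := by gcongr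
          _ = (1/2)^2 := by field_simp
      have hmem : ∀ c : ℝ, c ^ 2 = (1 / (2 * r)) ^ 2 → w + (c / T) • g ∈ K := by
        intro c hc
        have := hK hv (hd c hc) (a := 1 - 1 / T) (b := 1 / T) (by rw [sub_nonneg, div_le_one hT0]; linarith) (by positivity) (by ring)
        convert this using 1
        ext i; simp [hwdef]; ring
      have h1 := hmem (1 / (2 * r)) rfl
      have h2 := hmem (-(1 / (2 * r))) (by ring)
      have h3 := hψ.sym_bound hν hK hw h1 (by convert h2 using 1; ext i; simp; ring)
      rw [d2_smul] at h3
      have e : der2 ψ w g g = (2 * r * T) ^ 2 * ((1 / (2 * r) / T) ^ 2 * der2 ψ w g g) := by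
        field_simp
      rw [e]
      calc _ ≤ (2 * r * T) ^ 2 * (4 * ν) ^ 2 := by gcongr
        _ = _ := by ring
    have hlim : Tendsto (fun ε : ℝ => (8 * ν * T) ^ 2 * (√(der2 ψ w1 g g) + ε) ^ 2) (𝓝[>] 0)
        (𝓝 ((8 * ν * T) ^ 2 * der2 ψ w1 g g)) := by
      have hc : Continuous (fun ε : ℝ => (8 * ν * T) ^ 2 * (√(der2 ψ w1 g g) + ε) ^ 2) := by fun_prop
      have := hc.tendsto 0
      simp only [add_zero, Real.sq_sqrt hq1] at this
      exact this.mono_left nhdsWithin_le_nhds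
    refine ge_of_tendsto hlim ?_
    filter_upwards [self_mem_nhdsWithin] with ε hε
    have hε' : 0 < ε := hε
    have hs := Real.sqrt_nonneg (der2 ψ w1 g g)
    refine key _ (by positivity) ?_
    calc der2 ψ w1 g g = √(der2 ψ w1 g g) ^ 2 := (Real.sq_sqrt hq1).symm
      _ ≤ _ := by gcongr; linarith
  · have h2 : w - (1 / T) • (w1 - v) ∈ K := by
      convert hv using 1
      ext i; simp [hwdef]; ring
    have h1 : w + (1 / T) • (w1 - v) ∈ K := by
      have := hK hv hw1K (a := 1 - 2 / T) (b := 2 / T) (by rw [sub_nonneg, div_le_one hT0]; linarith) (by positivity) (by ring)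
      convert this using 1
      ext i; simp [hwdef]; ring
    have h3 := hψ.sym_bound hν hK hw h1 h2
    have e : w1 - w = (T - 1) • ((1 / T) • (w1 - v)) := by
      ext i; simp [hwdef]; field_simp; ring
    rw [e, d2_smul]
    calc _ ≤ (T - 1) ^ 2 * (4 * ν) ^ 2 := by gcongr
      _ ≤ T ^ 2 * (4 * ν) ^ 2 := by gcongr <;> linarith
      _ = _ := by ring
end scb2

section cmp
variable {d : ℕ} {K : Set (Fin d → ℝ)} {ψ : (Fin d → ℝ) → ℝ} {ν : ℝ}

lemma lift_compare (hψ : IsSCB K ψ ν) (hν : 1 ≤ ν) (hK : Convex ℝ K) (hKc : IsClosed K)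
    {w1 v : Fin d → ℝ} (hw1 : w1 ∈ interior K) (hv : v ∈ K) {T : ℝ} (hT : 2 ≤ T)
    (hw : w1 + (1 - 1 / T) • (v - w1) ∈ interior K) (hcrit : ∀ h, der1 ψ w1 h = 0)
    (p : Fin (d+1) → ℝ) :
    der2 (liftedBarrier ψ ν) (liftv (w1 + (1 - 1 / T) • (v - w1))) p p ≤
      (256 * (ν * T) ^ 2) * der2 (liftedBarrier ψ ν) (liftv w1) p p := by
  rw [(lift_ders hψ hw p).2, (lift_ders hψ hw1 p).2, hcrit]
  set β := p (Fin.last d)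
  obtain ⟨c1, c2⟩ := hψ.compare hν hK hKc (g := gdir w1 p) hw1 hv hT hw
  set w := w1 + (1 - 1 / T) • (v - w1)
  have hg : gdir w p = gdir w1 p + β • (w1 - w) := by
    ext i; simp [gdir, β]; ring
  have hpar := d2_par ψ w (gdir w1 p) (β • (w1 - w))
  have hnn := hψ.d2_nonneg hw (gdir w1 p - β • (w1 - w))
  rw [← hg, d2_smul ψ w (w1 - w)] at hpar
  have hq := hψ.d2_nonneg hw (gdir w p)
  have hq1 := hψ.d2_nonneg hw1 (gdir w1 p)
  have hgb := hψ.gradBound w hw (gdir w p)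
  have hab : -(2 * β * der1 ψ w (gdir w p)) ≤ ν * β ^ 2 + der2 ψ w (gdir w p) (gdir w p) := by
    have h1 : |der1 ψ w (gdir w p)| ^ 2 ≤ ν * der2 ψ w (gdir w p) (gdir w p) := by
      rw [← Real.sqrt_mul (by linarith)] at hgb
      calc _ ≤ √(ν * der2 ψ w (gdir w p) (gdir w p)) ^ 2 := by gcongr
        _ = _ := Real.sq_sqrt (by positivity)
    rw [sq_abs] at h1
    have hν0 : 0 < ν := by linarith
    have : ν * (-(2 * β * der1 ψ w (gdir w p))) ≤ ν * (ν * β ^ 2 + der2 ψ w (gdir w p) (gdir w p)) := by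
      nlinarith [sq_nonneg (ν * β + der1 ψ w (gdir w p))]
    exact le_of_mul_le_mul_left this hν0
  have hb2 : β ^ 2 * der2 ψ w (w1 - w) (w1 - w) ≤ β ^ 2 * (4 * ν * T) ^ 2 := by gcongr
  have hνT : 1 ≤ (ν * T) ^ 2 := by nlinarith [mul_le_mul hν hT (by norm_num) (by linarith)]
  have hβ := sq_nonneg β
  have h5 : ν * β ^ 2 ≤ ν * β^2 * (ν * T) ^ 2 := le_mul_of_one_le_right (by positivity) hνT
  have h6 : (ν * T) ^ 2 * β ^ 2 ≤ ν * ((ν * T) ^ 2 * β ^ 2) := le_mul_of_one_le_left (by positivity) hν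
  simp only [mul_zero, sub_zero]
  nlinarith

end cmp
end CC


section DD
open Set Filter Topology

lemma liftv_line {d : ℕ} (a b : Fin d → ℝ) (s : ℝ) :
    liftv a + s • (liftv b - liftv a) = liftv (a + s • (b - a)) := by
  ext i
  refine Fin.lastCases ?_ (fun j => ?_) i
  · simp [liftv_last]
  · simp [liftv_cast]

lemma liftv_inj {d : ℕ} {a b : Fin d → ℝ} (h : liftv a = liftv b) : a = b := by
  ext i
  have := congrFun h i.castSucc
  simpa [liftv_cast] using this

lemma mem_liftv_image {d : ℕ} {K : Set (Fin d → ℝ)} {a : Fin d → ℝ} : liftv a ∈ liftv '' K ↔ a ∈ K :=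
  ⟨fun ⟨b, hb, e⟩ => liftv_inj e ▸ hb, fun h => ⟨a, h, rfl⟩⟩

lemma mink_char {d : ℕ} {K : Set (Fin d → ℝ)} (hK : Convex ℝ K) (hKc : IsClosed K)
    {w1 : Fin d → ℝ} (hw1 : w1 ∈ K) {c : ℝ} (hc : 0 < c) (hc1 : c ≤ 1) {x : Fin d → ℝ} :
    (liftv x ∈ liftv '' K ∧ mink (liftv '' K) (liftv w1) (liftv x) ≤ c) ↔
      ∃ v ∈ K, x = w1 + c • (v - w1) := by
  have hset : {s : ℝ | 0 < s ∧ liftv w1 + s⁻¹ • (liftv x - liftv w1) ∈ liftv '' K} =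
      {s : ℝ | 0 < s ∧ w1 + s⁻¹ • (x - w1) ∈ K} := by
    ext s; simp only [Set.mem_ofPred_eq, liftv_line, mem_liftv_image]
  unfold mink
  rw [hset, mem_liftv_image]
  constructor
  · rintro ⟨hx, hinf⟩
    refine ⟨w1 + c⁻¹ • (x - w1), ?_, ?_⟩
    · have hs : ∀ s, c < s → w1 + s⁻¹ • (x - w1) ∈ K := by
        intro s hs
        have hne : {s : ℝ | 0 < s ∧ w1 + s⁻¹ • (x - w1) ∈ K}.Nonempty :=
          ⟨1, by norm_num, by simpa using hx⟩
        obtain ⟨a, ⟨ha0, haK⟩, has⟩ := exists_lt_of_csInf_lt hne (hinf.trans_lt hs)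
        have hs0 : 0 < s := ha0.trans has
        have := hK hw1 haK (a := 1 - a / s) (b := a / s)
          (by rw [sub_nonneg, div_le_one hs0]; exact has.le) (by positivity) (by ring)
        convert this using 1
        ext i; simp; field_simp; ring
      have ht : Tendsto (fun s : ℝ => w1 + s⁻¹ • (x - w1)) (𝓝[>] c) (𝓝 (w1 + c⁻¹ • (x - w1))) := by
        refine Tendsto.mono_left ?_ nhdsWithin_le_nhds
        exact tendsto_const_nhds.add ((tendsto_inv₀ hc.ne').smul tendsto_const_nhds)
      exact hKc.mem_of_tendsto ht (by filter_upwards [self_mem_nhdsWithin] with s h using hs s h)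
    · rw [add_sub_cancel_left, smul_smul, mul_inv_cancel₀ hc.ne', one_smul]; simp
  · rintro ⟨v, hv, rfl⟩
    constructor
    · have := hK hw1 hv (a := 1 - c) (b := c) (by linarith) hc.le (by ring)
      convert this using 1
      ext i; simp; ring
    · refine csInf_le ⟨0, fun s hs => hs.1.le⟩ ⟨hc, ?_⟩
      rw [add_sub_cancel_left, smul_smul, inv_mul_cancel₀ hc.ne', one_smul]
      simpa using hv

/-- Bregman divergence of `ψ` -/
noncomputable def bg {d : ℕ} (ψ : (Fin d → ℝ) → ℝ) (a b : Fin d → ℝ) : ℝ := ψ a - ψ b - der1 ψ b (a - b)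

lemma gdir_lift {d : ℕ} (w u : Fin d → ℝ) : gdir w (liftv u) = u - w := by
  ext i; simp [gdir, liftv_last, liftv_cast]
lemma gdir_lift_sub {d : ℕ} (w u v : Fin d → ℝ) : gdir w (liftv u - liftv v) = u - v := by
  ext i; simp [gdir, liftv_last, liftv_cast]

lemma breg_lift {d : ℕ} {K : Set (Fin d → ℝ)} {ψ : (Fin d → ℝ) → ℝ} {ν : ℝ} (hψ : IsSCB K ψ ν)
    {a b : Fin d → ℝ} (hb : b ∈ interior K) :
    breg (liftedBarrier ψ ν) (liftv a) (liftv b) = 400 * bg ψ a b := by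
  unfold breg bg
  rw [dotp_gradv, (lift_ders hψ hb _).1, gdir_lift_sub, lift_val, lift_val]
  simp [liftv_last]
  ring

lemma deriv_nonneg_of_min {G : ℝ → ℝ} {D : ℝ} (hG : HasDerivAt G D 0)
    (hmin : ∀ s ∈ Ioc (0:ℝ) 1, G 0 ≤ G s) : 0 ≤ D := by
  have := hG.tendsto_slope_zero_right
  refine ge_of_tendsto this ?_
  filter_upwards [Ioc_mem_nhdsGT (zero_lt_one (α := ℝ))] with s hs
  have h1 := hmin s hs
  have h2 := hs.1
  simp only [zero_add, smul_eq_mul]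
  have : 0 ≤ G s - G 0 := by linarith
  positivity

lemma omd_step {d : ℕ} {K : Set (Fin d → ℝ)} {ψ : (Fin d → ℝ) → ℝ} {ν : ℝ} (hψ : IsSCB K ψ ν)
    (hK : Convex ℝ K) {w w' u l : Fin d → ℝ} (hw : w ∈ interior K) (hw' : w' ∈ interior K)
    {η a : ℝ} (hη : 0 < η) (ha : 0 ≤ a) (hηa : η * a ≤ 5)
    (hl : |(w' - w) ⬝ᵥ l| ≤ 20 * a * √(der2 ψ w (w' - w) (w' - w)))
    (hopt : ∀ s ∈ Ioc (0:ℝ) 1, w' ⬝ᵥ l + 1 / η * (400 * bg ψ w' w) ≤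
      (w' + s • (u - w')) ⬝ᵥ l + 1 / η * (400 * bg ψ (w' + s • (u - w')) w)) :
    (w - u) ⬝ᵥ l ≤ 1 / η * (400 * bg ψ u w - 400 * bg ψ u w') + η * a ^ 2 := by
  have hder : 0 ≤ (u - w') ⬝ᵥ l + 1 / η * (400 * (der1 ψ w' (u - w') - der1 ψ w (u - w'))) := by
    have hw0 : w' + (0:ℝ) • (u - w') ∈ interior K := by simpa using hw'
    have h1 := line1 (f := ψ) (x := w') (h := u - w') (t := 0) (hψ.cda hw0)
    have h2 := ((hasDerivAt_id (0:ℝ)).mul_const ((u - w') ⬝ᵥ l)).add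
      (((h1.sub ((hasDerivAt_id (0:ℝ)).mul_const (der1 ψ w (u - w')))).const_mul 400).const_mul (1 / η))
    have h3 := deriv_nonneg_of_min h2 (fun s hs => ?_)
    · simpa using h3
    · have := hopt s hs
      unfold bg at this
      have e : w' + s • (u - w') - w = (w' - w) + s • (u - w') := by abel
      rw [e, d1_add, d1_smul, add_dotProduct, smul_dotProduct, smul_eq_mul] at this
      simp only [Pi.add_apply, Pi.sub_apply, id, zero_mul, zero_smul, add_zero, sub_zero, zero_add]
      simp only [one_div, sub_dotProduct, mul_sub, mul_add] at this ⊢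
      linarith
  have hbl := hψ.breg_lower hK hw hw'
  have hq := hψ.d2_nonneg hw (w' - w)
  have hsq := Real.sq_sqrt hq
  have hN0 := Real.sqrt_nonneg (der2 ψ w (w' - w) (w' - w))
  rw [← hsq, Real.sqrt_sq hN0] at hbl
  set N := √(der2 ψ w (w' - w) (w' - w)) with hN
  have hthree : bg ψ u w - bg ψ u w' - bg ψ w' w = der1 ψ w' (u - w') - der1 ψ w (u - w') := by
    unfold bg; simp only [d1_sub]; ring
  have hsplit : (w - u) ⬝ᵥ l = -((w' - w) ⬝ᵥ l) - (u - w') ⬝ᵥ l := by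
    simp only [sub_dotProduct]; ring
  have hbg : N ^ 2 / (2 * (1 + N)) ≤ bg ψ w' w := hbl
  have hkey : 20 * a * N - 1 / η * (400 * bg ψ w' w) ≤ η * a ^ 2 := by
    have h1 : η * (20 * a * N - 1 / η * (400 * bg ψ w' w)) ≤ η * (η * a ^ 2) := by
      have e : η * (20 * a * N - 1 / η * (400 * bg ψ w' w)) = 20 * (η * a) * N - 400 * bg ψ w' w := by
        field_simp
      have e2 : η * (η * a ^ 2) = (η * a) ^ 2 := by ring
      rw [e, e2]
      have hy : 0 ≤ η * a := by positivity
      generalize η * a = y at *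
      rcases le_total 1 N with h | h
      · have : N / 4 ≤ N ^ 2 / (2 * (1 + N)) := by
          rw [le_div_iff₀ (by positivity)]; nlinarith
        nlinarith
      · have : N ^ 2 / 4 ≤ N ^ 2 / (2 * (1 + N)) := by
          gcongr; linarith
        nlinarith [sq_nonneg (y - 10 * N)]
    exact le_of_mul_le_mul_left h1 hη
  have h5 := neg_le_of_abs_le hl
  rw [hsplit]
  have e3 : 1 / η * (400 * bg ψ u w - 400 * bg ψ u w') = 1 / η * (400 * bg ψ w' w) +
      1 / η * (400 * (der1 ψ w' (u - w') - der1 ψ w (u - w'))) := by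
    rw [← hthree]; ring
  rw [e3]
  linarith

lemma num_bound {d m : ℕ} {T ν : ℝ} (hd : 1 ≤ d) (hν : 1 ≤ ν) (hT : 2 ≤ T)
    (h : (2:ℝ) ^ m ≤ (T * (256 * (ν * T) ^ 2)) ^ (d + 1)) :
    (m : ℝ) ≤ 100 * d * Real.log (ν * T) := by
  have hνT : 2 ≤ ν * T := by nlinarith
  have hL : Real.log 2 ≤ Real.log (ν * T) := Real.log_le_log (by norm_num) hνT
  have hl2 : (0.69:ℝ) < Real.log 2 := by have := Real.log_two_gt_d9; linarith
  have h1 := Real.log_le_log (by positivity) h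
  rw [Real.log_pow, Real.log_pow, Real.log_mul (by positivity) (by positivity),
    Real.log_mul (by positivity) (by positivity), Real.log_pow] at h1
  have h256 : Real.log 256 = 8 * Real.log 2 := by
    rw [show (256:ℝ) = 2 ^ 8 by norm_num, Real.log_pow]; norm_num
  have hTl : Real.log T ≤ Real.log (ν * T) := Real.log_le_log (by linarith) (by nlinarith)
  have hd' : (1:ℝ) ≤ d := by exact_mod_cast hd
  push_cast at h1
  set L := Real.log (ν * T)
  have h2 : ((d:ℝ) + 1) * (Real.log T + (Real.log 256 + 2 * L)) ≤ (2 * d) * (11 * L) := by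
    rw [h256]
    have : Real.log T + (8 * Real.log 2 + 2 * L) ≤ 11 * L := by linarith
    have hL0 : 0 ≤ L := by linarith
    calc _ ≤ ((d:ℝ) + 1) * (11 * L) := by gcongr
      _ ≤ _ := by gcongr; linarith
  have hm : (0:ℝ) ≤ m := Nat.cast_nonneg m
  have h3 : (m:ℝ) * 0.69 ≤ m * Real.log 2 := by gcongr
  have h4 : 0 ≤ (d:ℝ) * L := by have : 0 ≤ L := by linarith
                                positivity
  nlinarith

lemma kappa_bound {d m : ℕ} {L : ℝ} (hd : 1 ≤ d) (hL : 0 < L) (hm : (m : ℝ) ≤ 100 * d * L) :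
    Real.exp (1 / (100 * d * L)) ^ m ≤ 5 := by
  have hd' : (1:ℝ) ≤ d := by exact_mod_cast hd
  rw [← Real.exp_nat_mul]
  have : (m:ℝ) * (1 / (100 * d * L)) ≤ 1 := by
    rw [mul_one_div, div_le_one (by positivity)]; exact hm
  have h1 := Real.exp_le_exp.2 this
  have := Real.exp_one_lt_d9
  linarith

lemma qnorm_bound {d : ℕ} {K : Set (Fin d → ℝ)} {ψ : (Fin d → ℝ) → ℝ} {ν : ℝ} (hψ : IsSCB K ψ ν)
    (hν : 1 ≤ ν) (hK : Convex ℝ K) {w u : Fin d → ℝ} (hw : w ∈ interior K) (hu : u ∈ K) {b : ℝ}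
    (hb : ψ w ≤ ψ u + ν * b) :
    qnorm (hess (liftedBarrier ψ ν) (liftv w)) (liftv u) ≤ 400 * bg ψ u w + 400 * ν * (2 + b) := by
  unfold qnorm
  rw [dotp_hess, (lift_ders hψ hw _).2, gdir_lift, liftv_last]
  obtain ⟨h1, h2⟩ := hψ.key hν hK hw hu
  have hq := hψ.d2_nonneg hw (u - w)
  have hsq := Real.sq_sqrt hq
  have hN0 := Real.sqrt_nonneg (der2 ψ w (u - w) (u - w))
  rw [← hsq]
  set N := √(der2 ψ w (u - w) (u - w))
  set a := der1 ψ w (u - w) with ha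
  have hbg : bg ψ u w = ψ u - ψ w - a := rfl
  have hX : 400 * (2 * ν - a) ≤ 400 * bg ψ u w + 400 * ν * (2 + b) := by
    rw [hbg]; nlinarith
  refine le_trans ?_ hX
  refine Real.sqrt_le_iff.2 ⟨by linarith, ?_⟩
  have h3 : N ≤ 3 * (2 * ν - a) := by linarith
  have h4 : N ^ 2 ≤ (3 * (2 * ν - a)) ^ 2 := by gcongr
  nlinarith

end DD

section EE

lemma step_facts {n : ℕ} {R M : Matrix (Fin n) (Fin n) ℝ} (hR : R.PosDef) (hs : R.IsSymm)
    (hM : R * R = M) {s : Fin n → ℝ} (h1 : s ⬝ᵥ s = 1) :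
    (R⁻¹ *ᵥ s) ⬝ᵥ M *ᵥ (R⁻¹ *ᵥ s) = 1 ∧
      (∀ q, |q ⬝ᵥ R *ᵥ s| ≤ √(q ⬝ᵥ M *ᵥ q)) ∧
      ∀ e, s ⬝ᵥ R⁻¹ *ᵥ e = e ⬝ᵥ (R⁻¹ *ᵥ s) := by
  have hu : IsUnit R.det := hR.isUnit.map Matrix.detMonoidHom
  have hsym : ∀ x y, x ⬝ᵥ R *ᵥ y = (R *ᵥ x) ⬝ᵥ y := by
    intro x y
    rw [dotProduct_mulVec, ← mulVec_transpose, hs.eq]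
  have hM2 : ∀ q, q ⬝ᵥ M *ᵥ q = (R *ᵥ q) ⬝ᵥ (R *ᵥ q) := by
    intro q
    rw [← hM, ← mulVec_mulVec, hsym]
  have hinv : R *ᵥ (R⁻¹ *ᵥ s) = s := by
    rw [mulVec_mulVec, mul_nonsing_inv _ hu, one_mulVec]
  refine ⟨by rw [hM2, hinv, h1], fun q => ?_, fun e => ?_⟩
  · rw [hsym, hM2]
    refine Real.abs_le_sqrt ?_
    have := Finset.sum_mul_sq_le_sq_mul_sq Finset.univ (R *ᵥ q) s
    have e1 : ∑ i, s i ^ 2 = 1 := by rw [← h1]; simp [dotProduct, sq]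
    rw [e1, mul_one] at this
    calc _ ≤ _ := this
      _ = _ := by simp [dotProduct, sq]
  · have h2 : (R⁻¹).IsSymm := by
      unfold Matrix.IsSymm; rw [transpose_nonsing_inv, hs.eq]
    rw [dotProduct_mulVec, ← mulVec_transpose, h2.eq, dotProduct_comm]

lemma card_ind {n T : ℕ} {H : ℕ → Matrix (Fin n) (Fin n) ℝ} {S : ℕ → Finset ℕ} {e : ℕ → ℝ} {κ η : ℝ}
    (hH : ∀ t ∈ Finset.Icc 1 (T + 1), (H t).PosDef) (he : e 1 = η) (hS : S 1 = {1})
    (hsch : ∀ t ∈ Finset.Icc 1 T,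
        ((∃ p : Fin n → ℝ, 0 < dotp p ((H (t + 1) - ∑ τ ∈ S t, H τ).mulVec p)) ∧
          S (t + 1) = insert (t + 1) (S t) ∧ e (t + 1) = κ * e t) ∨
          (S (t + 1) = S t ∧ e (t + 1) = e t)) :
    ∀ t, 1 ≤ t → t ≤ T + 1 → ∃ m : ℕ, (S t).card = m + 1 ∧ 1 ∈ S t ∧ S t ⊆ Finset.Icc 1 t ∧
      e t = κ ^ m * η ∧ (∑ τ ∈ S t, H τ).PosDef ∧ 2 ^ m * (H 1).det ≤ (∑ τ ∈ S t, H τ).det := by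
  intro t ht
  induction t, ht using Nat.le_induction with
  | base => intro _; exact ⟨0, by simp [hS, he, hH 1 (by simp)]⟩
  | succ t ht ih =>
    intro hT
    obtain ⟨m, h1, h2, h3, h4, h5, h6⟩ := ih (by omega)
    have hsub : Finset.Icc 1 t ⊆ Finset.Icc 1 (t + 1) := Finset.Icc_subset_Icc le_rfl (by omega)
    rcases hsch t (by simp; omega) with ⟨⟨p, hp⟩, hS', he'⟩ | ⟨hS', he'⟩
    · have hnot : t + 1 ∉ S t := fun h => by have := h3 h; simp at this
      refine ⟨m + 1, ?_, ?_, ?_, ?_, ?_, ?_⟩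
      · rw [hS', Finset.card_insert_of_notMem hnot, h1]
      · rw [hS']; exact Finset.mem_insert_of_mem h2
      · rw [hS']; exact Finset.insert_subset (by simp) (h3.trans hsub)
      · rw [he', h4]; ring
      · rw [hS', Finset.sum_insert hnot]
        exact (hH _ (by simp; omega)).add h5
      · rw [hS', Finset.sum_insert hnot, add_comm (H (t + 1))]
        have hpd := hH (t + 1) (by simp; omega)
        have := det_double (∑ τ ∈ S t, H τ) (H (t + 1)) h5 hpd.posSemidef p (by
          rw [dotp_eq, sub_mulVec, dotProduct_sub] at hp; linarith)
        rw [pow_succ]; linarith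
    · exact ⟨m, by rw [hS']; exact h1, by rw [hS']; exact h2, by rw [hS']; exact h3.trans hsub,
        by rw [he']; exact h4, by rw [hS']; exact h5, by rw [hS']; exact h6⟩

lemma telescope {T : ℕ} {S : ℕ → Finset ℕ} {D e : ℕ → ℝ} {κ η δ : ℝ} (hη : 0 < η) (hδ : 0 ≤ δ)
    (hκ : 1 + δ ≤ κ) (hD : ∀ t ∈ Finset.Icc 1 (T + 1), 0 ≤ D t)
    (he : e 1 = η) (hS : S 1 = {1}) (hSs : ∀ t ∈ Finset.Icc 1 T, S t ⊆ Finset.Icc 1 t)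
    (he0 : ∀ t ∈ Finset.Icc 1 T, 0 < e t ∧ e t ≤ 5 * η)
    (hsch : ∀ t ∈ Finset.Icc 1 T, (S (t + 1) = insert (t + 1) (S t) ∧ e (t + 1) = κ * e t) ∨
          (S (t + 1) = S t ∧ e (t + 1) = e t)) :
    ∀ t, 1 ≤ t → t ≤ T → ∑ τ ∈ Finset.Icc 1 t, 1 / e τ * (D τ - D (τ + 1)) ≤
      D 1 / η - δ / (5 * η) * ∑ s ∈ S t \ {1}, D s - D (t + 1) / e t := by
  intro t ht
  induction t, ht using Nat.le_induction with
  | base => 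
    intro _; simp [hS, he]
    apply le_of_eq; ring
  | succ t ht ih =>
    intro hT
    have ih := ih (by omega)
    rw [Finset.sum_Icc_succ_top (by omega)]
    obtain ⟨p1, p2⟩ := he0 t (by simp; omega)
    obtain ⟨q1, q2⟩ := he0 (t+1) (by simp; omega)
    have hDt := hD (t + 1) (by simp; omega)
    have e1 : 1 / e (t + 1) * (D (t + 1) - D (t + 1 + 1)) = D (t + 1) / e (t + 1) - D (t + 1 + 1) / e (t + 1) := by
      ring
    rw [e1]
    rcases hsch t (by simp; omega) with ⟨hS', he'⟩ | ⟨hS', he'⟩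
    · have hnot : t + 1 ∉ S t \ {1} := fun h => by
        have := hSs t (by simp; omega) (Finset.mem_sdiff.1 h).1; simp at this
      have e2 : S (t + 1) \ {1} = insert (t + 1) (S t \ {1}) := by
        rw [hS', Finset.insert_sdiff_of_notMem _ (by simp; omega)]
      rw [e2, Finset.sum_insert hnot, mul_add]
      have : D (t + 1) / e (t + 1) + δ / (5 * η) * D (t + 1) ≤ D (t + 1) / e t := by
        have a1 : 1 / e t = κ / e (t + 1) := by
          have : κ ≠ 0 := by linarith
          rw [he']; field_simp
        have a2 : D (t + 1) / e t = κ / e (t + 1) * D (t + 1) := by rw [← a1]; ring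
        have a3 : δ / (5 * η) ≤ δ / e (t + 1) := by gcongr
        have a4 : (1 + δ) / e (t + 1) ≤ κ / e (t + 1) := by gcongr
        rw [a2]
        calc _ ≤ D (t + 1) / e (t + 1) + δ / e (t + 1) * D (t + 1) := by gcongr
          _ = (1 + δ) / e (t + 1) * D (t + 1) := by ring
          _ ≤ _ := by gcongr
      linarith
    · rw [hS', he'] at *
      linarith
end EE

set_option maxHeartbeats 2000000

/-- **Lemma B.7: bound on the OMD regret term for linear bandits.**
Let `S` be the final set of rounds at which Algorithm 2 increased its learning rate and
`S' = S \ {1, T+1}`.  If `η ≤ 1/(80d)`, then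
`∑_{t=1}^T ⟨w⁺_t − u⁺, ℓ̂⁺_t⟩ ≤ Õ(ν/η) − (∑_{s∈S'} ‖u⁺‖_{H_s})/(500 η d ln(νT)) + 40 η d² L̄_T`,
where `L̄_T = ∑_t |⟨w̃⁺_t, ℓ⁺_t⟩|` and `Õ` hides factors logarithmic in `d, ν, T`. -/
theorem omd_regret_term_bound :
    ∃ c : ℝ, 0 < c ∧ ∃ k : ℕ,
    ∀ (d T : ℕ) (hd : 1 ≤ d) (hT : 2 ≤ T) (ν η : ℝ) (hν : 1 ≤ ν) (hη : 0 < η)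
      (hη80 : η ≤ 1 / (80 * (d : ℝ)))
      (Ωs : Set (Fin d → ℝ)) (hconv : Convex ℝ Ωs) (hcomp : IsCompact Ωs)
      (hint : (interior Ωs).Nonempty)
      (ψ : (Fin d → ℝ) → ℝ) (hψ : IsSCB Ωs ψ ν)
      (ℓv : ℕ → Fin d → ℝ) (hℓ : ∀ t ∈ Finset.Icc 1 T, ∀ w ∈ Ωs, |dotp w (ℓv t)| ≤ 1)
      (sv wp : ℕ → Fin (d + 1) → ℝ)
      (R : ℕ → Matrix (Fin (d + 1)) (Fin (d + 1)) ℝ)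
      (ηv : ℕ → ℝ) (S : ℕ → Finset ℕ)
      (Ψ : (Fin (d + 1) → ℝ) → ℝ) (hΨ : Ψ = liftedBarrier ψ ν)
      (Ωp : Set (Fin (d + 1) → ℝ)) (hΩp : Ωp = liftv '' Ωs)
      (H : ℕ → Matrix (Fin (d + 1)) (Fin (d + 1)) ℝ) (hH : ∀ t, H t = hess Ψ (wp t))
      (elast : Fin (d + 1) → ℝ) (helast : elast = Pi.single (Fin.last d) 1)
      (lp : ℕ → Fin (d + 1) → ℝ) (hlp : ∀ t, lp t = Fin.snoc (ℓv t) 0)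
      (wt : ℕ → Fin (d + 1) → ℝ) (hwt : ∀ t, wt t = wp t + (R t)⁻¹.mulVec (sv t))
      (lh : ℕ → Fin (d + 1) → ℝ)
      (hlh : ∀ t, lh t = ((d : ℝ) * dotp (wt t) (lp t)) • (R t).mulVec (sv t))
      (Ωp' : Set (Fin (d + 1) → ℝ))
      (hΩp' : Ωp' = {x ∈ Ωp | mink Ωp (wp 1) x ≤ 1 - 1 / (T : ℝ)})
      (hinit : wp 1 ∈ Ωp ∧ ∀ y ∈ Ωp, Ψ (wp 1) ≤ Ψ y)
      (hR : ∀ t ∈ Finset.Icc 1 (T + 1), (R t).PosDef ∧ (R t).IsSymm ∧ R t * R t = H t)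
      (hs : ∀ t ∈ Finset.Icc 1 T,
        dotp (sv t) (sv t) = 1 ∧ dotp (sv t) ((R t)⁻¹.mulVec elast) = 0)
      (hupd : ∀ t ∈ Finset.Icc 1 T, wp (t + 1) ∈ Ωp' ∧ ∀ y ∈ Ωp',
        dotp (wp (t + 1)) (lh t) + (1 / ηv t) * breg Ψ (wp (t + 1)) (wp t)
          ≤ dotp y (lh t) + (1 / ηv t) * breg Ψ y (wp t))
      (hη1 : ηv 1 = η) (hS1 : S 1 = {1})
      (hsch : ∀ t ∈ Finset.Icc 1 T,
        ((∃ p : Fin (d + 1) → ℝ,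
            0 < dotp p ((H (t + 1) - ∑ τ ∈ S t, H τ).mulVec p)) →
          S (t + 1) = insert (t + 1) (S t) ∧
          ηv (t + 1) = Real.exp (1 / (100 * d * Real.log (ν * T))) * ηv t) ∧
        (¬ (∃ p : Fin (d + 1) → ℝ,
            0 < dotp p ((H (t + 1) - ∑ τ ∈ S t, H τ).mulVec p)) →
          S (t + 1) = S t ∧ ηv (t + 1) = ηv t))
      -- comparator
      (ustar : Fin d → ℝ) (hustar : ustar ∈ Ωs)
      (up : Fin (d + 1) → ℝ)
      (hup : up = (1 - 1 / (T : ℝ)) • liftv ustar + (1 / (T : ℝ)) • wp 1),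
    ∑ t ∈ Finset.Icc 1 T, dotp (wp t - up) (lh t)
      ≤ c * (Real.log ((d : ℝ) * ν * T)) ^ k * (ν / η)
        - (∑ s ∈ (S (T + 1)) \ {1, T + 1}, qnorm (H s) up) /
            (500 * η * d * Real.log (ν * T))
        + 40 * η * (d : ℝ) ^ 2 * ∑ t ∈ Finset.Icc 1 T, |dotp (wt t) (lp t)| := by
  refine ⟨1000, by norm_num, 1, ?_⟩
  intro d T hd hT ν η hν hη hη80 Ωs hconv hcomp hint ψ hψ ℓv hℓ sv wp R ηv S Ψ hΨ Ωp hΩp H hH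
    elast helast lp hlp wt hwt lh hlh Ωp' hΩp' hinit hR hs hupd hη1 hS1 hsch ustar hustar up hup
  subst hΨ hΩp helast
  have hKc := hcomp.isClosed
  have hT' : (2:ℝ) ≤ T := by exact_mod_cast hT
  have hd' : (1:ℝ) ≤ d := by exact_mod_cast hd
  have hTi : 0 < 1 / (T:ℝ) := by positivity
  have hTi2 : 1 / (T:ℝ) ≤ 1 / 2 := by gcongr
  set c0 : ℝ := 1 - 1 / (T:ℝ) with hc0
  have hc0pos : 0 < c0 := by linarith
  have hc0I : c0 ∈ Set.Ico (0:ℝ) 1 := ⟨hc0pos.le, by linarith⟩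
  have hlog1 : Real.log (1 - c0) = - Real.log T := by
    rw [hc0, sub_sub_cancel, one_div, Real.log_inv]
  obtain ⟨⟨w1, hw1K, hw1e⟩, hmin⟩ := hinit
  obtain ⟨x0, hx0⟩ := hint
  have hHpd : ∀ t ∈ Finset.Icc 1 (T + 1), (H t).PosDef := by
    intro t ht
    obtain ⟨h1, h2, h3⟩ := hR t ht
    rw [← h3]
    refine Matrix.PosSemidef.posDef_iff_isUnit ?_ |>.2 (h1.isUnit.mul h1.isUnit)
    have h4 := Matrix.posSemidef_conjTranspose_mul_self (R t)
    rwa [h1.isHermitian.eq] at h4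
  have hw1i : w1 ∈ interior Ωs := by
    by_contra hcon
    have h0 := hess_bdry hψ hconv hKc hw1K hcon hx0
    have h1 := (hHpd 1 (by simp)).det_pos
    rw [hH, ← hw1e, h0, Matrix.det_zero] at h1
    exact lt_irrefl _ h1
  have hminψ : ∀ y ∈ Ωs, ψ w1 ≤ ψ y := by
    intro y hy
    have := hmin (liftv y) ⟨y, hy, rfl⟩
    rw [← hw1e, lift_val, lift_val] at this
    linarith
  have hcrit : ∀ h, der1 ψ w1 h = 0 := by
    intro h
    have : IsLocalMin ψ w1 := by
      filter_upwards [isOpen_interior.mem_nhds hw1i] with y hy using hminψ y (interior_subset hy)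
    unfold der1
    rw [this.fderiv_eq_zero]; rfl
  have hmc : ∀ x, liftv x ∈ Ωp' ↔ ∃ v ∈ Ωs, x = w1 + c0 • (v - w1) := by
    intro x
    rw [hΩp', ← hw1e]
    exact mink_char hconv hKc hw1K hc0pos (by linarith)
  have hVex : ∀ t, ∃ v, t ∈ Finset.Icc 1 (T + 1) → v ∈ Ωs ∧ wp t = liftv (w1 + c0 • (v - w1)) := by
    intro t
    by_cases ht : t ∈ Finset.Icc 1 (T + 1)
    · rw [Finset.mem_Icc] at ht
      rcases Nat.lt_or_ge 1 t with h | h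
      · obtain ⟨s, rfl⟩ : ∃ s, t = s + 1 := ⟨t - 1, by omega⟩
        have h1 := (hupd s (by simp; omega)).1
        have h2 : wp (s + 1) ∈ liftv '' Ωs := by rw [hΩp'] at h1; exact h1.1
        obtain ⟨x, hx, hxe⟩ := h2
        rw [← hxe] at h1
        obtain ⟨v, hv, hve⟩ := (hmc x).1 h1
        exact ⟨v, fun _ => ⟨hv, by rw [← hxe, hve]⟩⟩
      · have : t = 1 := by omega
        subst this
        exact ⟨w1, fun _ => ⟨hw1K, by simp [hw1e]⟩⟩
    · exact ⟨w1, fun h => absurd h ht⟩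
  choose V hV using hVex
  set W : ℕ → Fin d → ℝ := fun t => w1 + c0 • (V t - w1) with hW
  have hWi : ∀ t ∈ Finset.Icc 1 (T + 1), W t ∈ interior Ωs := fun t ht =>
    seg_int hconv hw1i (hV t ht).1 hc0I
  have hWe : ∀ t ∈ Finset.Icc 1 (T + 1), wp t = liftv (W t) := fun t ht => (hV t ht).2
  have hW1 : W 1 = w1 := liftv_inj (by rw [← hWe 1 (by simp), hw1e])
  set u : Fin d → ℝ := w1 + c0 • (ustar - w1) with hu
  have hui : u ∈ interior Ωs := seg_int hconv hw1i hustar hc0I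
  have hupu : up = liftv u := by
    rw [hup, ← hw1e, hu, ← liftv_line, show (1 / (T:ℝ)) = 1 - c0 by rw [hc0]; ring]
    module
  -- step size facts
  set L : ℝ := Real.log (ν * T) with hL
  have hνT : 2 ≤ ν * T := by nlinarith
  have hLpos : 0 < L := Real.log_pos (by linarith)
  set κ : ℝ := Real.exp (1 / (100 * d * L)) with hκ
  have hsch2 : ∀ t ∈ Finset.Icc 1 T,
      ((∃ p : Fin (d + 1) → ℝ, 0 < dotp p ((H (t + 1) - ∑ τ ∈ S t, H τ).mulVec p)) ∧
          S (t + 1) = insert (t + 1) (S t) ∧ ηv (t + 1) = κ * ηv t) ∨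
          (S (t + 1) = S t ∧ ηv (t + 1) = ηv t) := by
    intro t ht
    by_cases h : ∃ p : Fin (d + 1) → ℝ, 0 < dotp p ((H (t + 1) - ∑ τ ∈ S t, H τ).mulVec p)
    · exact Or.inl ⟨h, (hsch t ht).1 h⟩
    · exact Or.inr ((hsch t ht).2 h)
  have hcard := card_ind hHpd hη1 hS1 hsch2
  have hcomp1 : ∀ t ∈ Finset.Icc 1 (T + 1), ∀ p : Fin (d + 1) → ℝ,
      p ⬝ᵥ H t *ᵥ p ≤ (256 * (ν * T) ^ 2) * (p ⬝ᵥ H 1 *ᵥ p) := by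
    intro t ht p
    have := lift_compare hψ hν hconv hKc hw1i (hV t ht).1 hT' (hWi t ht) hcrit p
    rw [← dotp_hess, ← dotp_hess, ← hc0, ← (hV t ht).2, hw1e, ← hH, ← hH] at this
    exact this
  have hm : ∀ t ∈ Finset.Icc 1 T, ((S t).card : ℝ) ≤ 100 * d * L + 1 ∧ 0 < ηv t ∧ ηv t ≤ 5 * η ∧
      1 ∈ S t ∧ S t ⊆ Finset.Icc 1 t := by
    intro t ht
    rw [Finset.mem_Icc] at ht
    obtain ⟨m, h1, h2, h3, h4, h5, h6⟩ := hcard t ht.1 (by omega)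
    have hdet : (∑ τ ∈ S t, H τ).det ≤ (T * (256 * (ν * T) ^ 2)) ^ (d + 1) * (H 1).det := by
      refine det_le_of_le (H 1) _ (hHpd 1 (by simp)) h5.posSemidef _ (fun p => ?_)
      rw [Matrix.sum_mulVec, dotProduct_sum]
      have hp0 : 0 ≤ p ⬝ᵥ H 1 *ᵥ p := by
        simpa using (hHpd 1 (by simp)).posSemidef.dotProduct_mulVec_nonneg p
      calc _ ≤ ∑ τ ∈ S t, (256 * (ν * T) ^ 2) * (p ⬝ᵥ H 1 *ᵥ p) := by
            refine Finset.sum_le_sum fun τ hτ => hcomp1 τ ?_ p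
            have := h3 hτ
            simp at this ⊢; omega
        _ = (S t).card * ((256 * (ν * T) ^ 2) * (p ⬝ᵥ H 1 *ᵥ p)) := by
            rw [Finset.sum_const, nsmul_eq_mul]
        _ ≤ T * ((256 * (ν * T) ^ 2) * (p ⬝ᵥ H 1 *ᵥ p)) := by
            have : (S t).card ≤ T := by
              have := Finset.card_le_card h3
              simp at this; omega
            gcongr
        _ = _ := by ring
    have h7 := h6.trans hdet
    have h8 := le_of_mul_le_mul_right h7 (hHpd 1 (by simp)).det_pos
    have h9 := num_bound hd hν hT' h8
    have h10 := kappa_bound hd hLpos h9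
    refine ⟨by rw [h1]; push_cast; linarith, ?_, ?_, h2, h3⟩
    · rw [h4]; have := Real.exp_pos (1 / (100 * d * L)); positivity
    · rw [h4]; gcongr
  -- divergences
  set D : ℕ → ℝ := fun t => 400 * bg ψ u (W t) with hD
  have hD0 : ∀ t ∈ Finset.Icc 1 (T + 1), 0 ≤ D t := by
    intro t ht
    have h1 := hψ.breg_lower hconv (hWi t ht) hui
    have h2 := hψ.d2_nonneg (hWi t ht) (u - W t)
    have h3 : 0 ≤ bg ψ u (W t) := le_trans (by positivity) h1
    simp only [hD]; positivity
  -- per step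
  have hstep : ∀ t ∈ Finset.Icc 1 T, dotp (wp t - up) (lh t) ≤
      1 / ηv t * (D t - D (t + 1)) + 40 * η * (d:ℝ) ^ 2 * |dotp (wt t) (lp t)| := by
    intro t ht
    have ht' := Finset.mem_Icc.1 ht
    have hti : t ∈ Finset.Icc 1 (T + 1) := by simp; omega
    have hti' : t + 1 ∈ Finset.Icc 1 (T + 1) := by simp; omega
    obtain ⟨-, hη0, hη5, -, -⟩ := hm t ht
    obtain ⟨r1, r2, r3⟩ := hR t hti
    obtain ⟨s1, s2⟩ := hs t ht
    rw [dotp_eq] at s1 s2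
    obtain ⟨f1, f2, f3⟩ := step_facts r1 r2 r3 s1
    rw [f3] at s2
    set p := (R t)⁻¹ *ᵥ sv t with hp
    have hplast : p (Fin.last d) = 0 := by simpa using s2
    set h : Fin d → ℝ := fun i => p i.castSucc with hh
    have hgd : gdir (W t) p = h := by ext i; simp [gdir, hplast, hh]
    have hquad : ∀ q : Fin (d + 1) → ℝ, q (Fin.last d) = 0 →
        q ⬝ᵥ H t *ᵥ q = 400 * der2 ψ (W t) (gdir (W t) q) (gdir (W t) q) := by
      intro q hq
      rw [← dotp_eq, hH, hWe t hti, dotp_hess, (lift_ders hψ (hWi t hti) q).2, hq]; ring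
    have hder : 400 * der2 ψ (W t) h h = 1 := by
      rw [← hgd, ← hquad p hplast, f1]
    have hdik : W t + h ∈ Ωs := by
      refine hψ.dikin hconv hKc (hWi t hti) ?_
      refine Real.sqrt_le_iff.2 ⟨by norm_num, by linarith⟩
    have hL1 : |dotp (wt t) (lp t)| ≤ 1 := by
      have := hℓ t ht _ hdik
      have e : dotp (wt t) (lp t) = dotp (W t + h) (ℓv t) := by
        rw [hwt, hlp, hWe t hti]
        unfold dotp
        rw [Fin.sum_univ_castSucc]
        simp [liftv_cast, hh, hp]
      rw [e]; exact this
    set Lt := dotp (wt t) (lp t) with hLt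
    have hlhdot : ∀ a b : Fin d → ℝ, (a - b) ⬝ᵥ (fun i => lh t i.castSucc) = (liftv a - liftv b) ⬝ᵥ lh t := by
      intro a b
      unfold dotProduct
      rw [Fin.sum_univ_castSucc]
      simp [liftv_cast, liftv_last]
    have hlhdot1 : ∀ a : Fin d → ℝ, dotp (liftv a) (lh t) = a ⬝ᵥ (fun i => lh t i.castSucc) + lh t (Fin.last d) := by
      intro a
      unfold dotp dotProduct
      rw [Fin.sum_univ_castSucc]
      simp [liftv_cast, liftv_last]
    have habs : 0 ≤ |Lt| := abs_nonneg _
    have hae : ηv t * (d * |Lt|) ≤ 5 * η * (d * |Lt|) := by gcongr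
    have hdη : η * d ≤ 1 / 80 := by
      have := mul_le_mul_of_nonneg_right hη80 (by linarith : (0:ℝ) ≤ d)
      calc _ ≤ _ := this
        _ = _ := by field_simp
    have main := omd_step (u := u) (l := fun i => lh t i.castSucc) hψ hconv (hWi t hti) (hWi (t + 1) hti') hη0
      (a := d * |Lt|) (by positivity) (by nlinarith) ?_ ?_
    · rw [hlhdot, ← hWe t hti, ← hupu] at main
      rw [dotp_eq]
      refine main.trans ?_
      have : ηv t * (d * |Lt|) ^ 2 ≤ 40 * η * (d:ℝ) ^ 2 * |Lt| := by
        have a1 : |Lt| ^ 2 ≤ |Lt| := by nlinarith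
        calc _ ≤ 5 * η * (d * |Lt|) ^ 2 := by gcongr
          _ = 5 * η * (d:ℝ) ^ 2 * |Lt| ^ 2 := by ring
          _ ≤ 5 * η * (d:ℝ) ^ 2 * |Lt| := by gcongr
          _ ≤ _ := by gcongr; norm_num
      linarith
    · rw [hlhdot, hlh, dotProduct_smul, smul_eq_mul, abs_mul, abs_mul, Nat.abs_cast]
      have h1 := f2 (liftv (W (t + 1)) - liftv (W t))
      rw [hquad _ (by simp [liftv_last]), gdir_lift_sub, Real.sqrt_mul (by norm_num),
        show √(400:ℝ) = 20 by rw [show (400:ℝ) = 20 ^ 2 by norm_num]; exact Real.sqrt_sq (by norm_num)] at h1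
      calc _ ≤ d * |Lt| * (20 * _) := by gcongr
        _ = _ := by ring
    · intro s hs
      have hmem : liftv (W (t + 1) + s • (u - W (t + 1))) ∈ Ωp' := by
        rw [hmc]
        refine ⟨(1 - s) • V (t + 1) + s • ustar, hconv (hV _ hti').1 hustar (by linarith [hs.2]) hs.1.le (by ring), ?_⟩
        simp only [hW, hu]
        module
      have := (hupd t ht).2 _ hmem
      rw [hWe t hti, hWe _ hti', breg_lift hψ (hWi t hti), breg_lift hψ (hWi t hti), hlhdot1, hlhdot1] at this
      linarith
  -- telescoping
  have hδ : 0 ≤ 1 / (100 * d * L) := by positivity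
  have htel := telescope (D := D) hη hδ (by rw [hκ]; linarith [Real.add_one_le_exp (1 / (100 * d * L))]) hD0 hη1 hS1
    (fun t ht => (hm t ht).2.2.2.2) (fun t ht => ⟨(hm t ht).2.1, (hm t ht).2.2.1⟩)
    (fun t ht => (hsch2 t ht).imp (fun h => h.2) id) T (by omega) le_rfl
  have hTm : T ∈ Finset.Icc 1 T := by simp; omega
  have hT1m : T + 1 ∈ Finset.Icc 1 (T + 1) := by simp
  obtain ⟨hcardT, hηT, -, h1T, hsubT⟩ := hm T hTm
  have hST : S (T + 1) \ {1, T + 1} = S T \ {1} := by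
    have hnot : T + 1 ∉ S T := fun h => by have := hsubT h; simp at this
    rcases hsch2 T hTm with ⟨-, h, -⟩ | ⟨h, -⟩
    · rw [h]; ext x
      simp only [Finset.mem_sdiff, Finset.mem_insert, Finset.mem_singleton]
      constructor
      · rintro ⟨h1, h2⟩; tauto
      · rintro ⟨h1, h2⟩
        have : x ≠ T + 1 := fun h => hnot (h ▸ h1)
        tauto
    · rw [h]; ext x
      simp only [Finset.mem_sdiff, Finset.mem_insert, Finset.mem_singleton]
      constructor
      · rintro ⟨h1, h2⟩; tauto
      · rintro ⟨h1, h2⟩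
        have : x ≠ T + 1 := fun h => hnot (h ▸ h1)
        tauto
  have hcard' : ((S T \ {1}).card : ℝ) ≤ 100 * d * L := by
    have h1 : (S T \ {1}).card + 1 = (S T).card := by
      rw [Finset.sdiff_singleton_eq_erase, Finset.card_erase_add_one h1T]
    have h2 : ((S T \ {1}).card : ℝ) + 1 = (S T).card := by exact_mod_cast h1
    linarith
  set lT := Real.log T with hlT
  have hlT0 : 0 ≤ lT := Real.log_nonneg (by linarith)
  set B : ℝ := 400 * ν * (2 + lT) with hB
  have hB0 : 0 ≤ B := by positivity
  have hDs : ∀ s ∈ S T \ {1}, qnorm (H s) up - B ≤ D s := by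
    intro s hs
    have hsI : s ∈ Finset.Icc 1 (T + 1) := by
      have := hsubT (Finset.mem_sdiff.1 hs).1
      simp at this ⊢; omega
    have hg := hψ.growth hν hconv hw1i (hV s hsI).1 hc0I
    rw [hlog1] at hg
    have := qnorm_bound hψ hν hconv (hWi s hsI) (interior_subset hui) (b := lT) (by
      have := hminψ u (interior_subset hui)
      simp only [hW]; linarith)
    rw [hH, hWe s hsI, hupu]
    simp only [hD]; linarith
  have hsum : ∑ s ∈ S T \ {1}, qnorm (H s) up - 100 * d * L * B ≤ ∑ s ∈ S T \ {1}, D s := by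
    have h1 := Finset.sum_le_sum hDs
    rw [Finset.sum_sub_distrib, Finset.sum_const, nsmul_eq_mul] at h1
    have h2 : ((S T \ {1}).card : ℝ) * B ≤ 100 * d * L * B := by gcongr
    linarith
  have hD1 : D 1 ≤ 400 * (ν * lT) := by
    have hg := hψ.growth hν hconv hw1i hustar hc0I
    rw [hlog1] at hg
    simp only [hD, bg, hW1, hcrit]
    rw [← hu] at hg
    linarith
  have hDT : 0 ≤ D (T + 1) / ηv T := div_nonneg (hD0 _ hT1m) hηT.le
  have hlogs : 400 * lT + 80 * (2 + lT) ≤ 1000 * Real.log (d * ν * T) := by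
    have h1 : lT ≤ Real.log (d * ν * T) := Real.log_le_log (by linarith) (by nlinarith [mul_le_mul hd' hν zero_le_one (by linarith)])
    have h2 : Real.log 2 ≤ lT := Real.log_le_log (by norm_num) hT'
    have := Real.log_two_gt_d9
    linarith
  have hfin : D 1 / η - 1 / (100 * d * L) / (5 * η) * ∑ s ∈ S T \ {1}, D s ≤
      1000 * Real.log (d * ν * T) * (ν / η) - (∑ s ∈ S T \ {1}, qnorm (H s) up) / (500 * η * d * L) := by
    have a1 : D 1 / η ≤ 400 * lT * (ν / η) := by
      calc _ ≤ 400 * (ν * lT) / η := by gcongr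
        _ = _ := by ring
    have a2 : 1 / (100 * d * L) / (5 * η) * (∑ s ∈ S T \ {1}, qnorm (H s) up - 100 * d * L * B) ≤
        1 / (100 * d * L) / (5 * η) * ∑ s ∈ S T \ {1}, D s := by gcongr
    have a3 : 1 / (100 * d * L) / (5 * η) * (∑ s ∈ S T \ {1}, qnorm (H s) up - 100 * d * L * B) =
        (∑ s ∈ S T \ {1}, qnorm (H s) up) / (500 * η * d * L) - 80 * (2 + lT) * (ν / η) := by
      rw [hB]; field_simp; ring
    have a4 : (400 * lT + 80 * (2 + lT)) * (ν / η) ≤ 1000 * Real.log (d * ν * T) * (ν / η) := by gcongr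
    rw [a3] at a2
    linarith
  rw [hST, pow_one, Finset.mul_sum]
  have h1 := Finset.sum_le_sum hstep
  rw [Finset.sum_add_distrib] at h1
  linarith
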